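/- arXiv:0706.1536 — 2 statements merged into one kernel-verified Lean document; each statement's English description precedes it below -/
import Mathlib

section
/- Let A be an n×n complex normal matrix and 1 ≤ k ≤ n. If μ ∈ ℂ satisfies e^{iξ}μ + e^{-iξ}μ̄ ≤ λ_k(e^{iξ}A + e^{-iξ}A*) for every ξ ∈ [0, 2π), then μ ∈ Λ_k(A); that is, Ω_k(A) ⊆ Λ_k(A) for normal A. -/
open Matrix

/-- The `k`-th largest eigenvalue (counted with multiplicity) of a Hermitian matrix `H`;
junk value `0` if `H` is not Hermitian. -/
noncomputable def lambdaKth {n : ℕ} (H : Matrix (Fin n) (Fin n) ℂ) (k : ℕ) : ℝ :=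
  if hH : H.IsHermitian then
    ((Finset.univ.val.map hH.eigenvalues).sort (· ≤ ·)).getD (n - k) 0
  else 0

/-- The rank-`k` numerical range of a matrix `A`:
`{λ : PAP = λP` for some rank-`k` orthogonal projection `P}`. -/
def rankKRange {n : ℕ} (k : ℕ) (A : Matrix (Fin n) (Fin n) ℂ) : Set ℂ :=
  {μ | ∃ P : Matrix (Fin n) (Fin n) ℂ,
    P.IsHermitian ∧ P * P = P ∧ P.rank = k ∧ P * A * P = μ • P}

/-- `HasIsotropic d S k`: the form `∑ j, d j * conj (x j) * y j` vanishes on a subspace of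
dimension at least `k` consisting of vectors supported in `S`. -/
def HasIsotropic {ι : Type*} [Fintype ι] (d : ι → ℂ) (S : Finset ι) (k : ℕ) : Prop :=
  ∃ V : Submodule ℂ (ι → ℂ), k ≤ Module.finrank ℂ V ∧ (∀ x ∈ V, ∀ j ∉ S, x j = 0) ∧
    ∀ x ∈ V, ∀ y ∈ V, ∑ j, d j * (star (x j) * y j) = 0

section Isotropic

variable {ι : Type*} [Fintype ι] {d : ι → ℂ}

lemma HasIsotropic.zero (S : Finset ι) : HasIsotropic d S 0 :=
  ⟨⊥, by simp, by simp +contextual, by simp +contextual⟩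

lemma HasIsotropic.mono {S T : Finset ι} {k l : ℕ} (h : HasIsotropic d S k) (hST : S ⊆ T)
    (hlk : l ≤ k) : HasIsotropic d T l := by
  obtain ⟨V, h1, h2, h3⟩ := h
  exact ⟨V, hlk.trans h1, fun x hx j hj => h2 x hx j fun h => hj (hST h), h3⟩

lemma HasIsotropic.union [DecidableEq ι] {S T : Finset ι} {k l : ℕ} (hS : HasIsotropic d S k)
    (hT : HasIsotropic d T l) (hST : Disjoint S T) : HasIsotropic d (S ∪ T) (k + l) := by
  obtain ⟨V, hV1, hV2, hV3⟩ := hS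
  obtain ⟨W, hW1, hW2, hW3⟩ := hT
  have hdisj : V ⊓ W = ⊥ := by
    rw [Submodule.eq_bot_iff]
    rintro x ⟨hx, hx'⟩
    funext j
    by_cases hj : j ∈ S
    · exact hW2 x hx' j (Finset.disjoint_left.mp hST hj)
    · exact hV2 x hx j hj
  have hcross : ∀ x ∈ V, ∀ y ∈ W, ∀ j, x j = 0 ∨ y j = 0 := by
    intro x hx y hy j
    by_cases hj : j ∈ S
    · exact Or.inr (hW2 y hy j (Finset.disjoint_left.mp hST hj))
    · exact Or.inl (hV2 x hx j hj)
  refine ⟨V ⊔ W, ?_, ?_, ?_⟩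
  · have := Submodule.finrank_sup_add_finrank_inf_eq V W
    rw [hdisj, finrank_bot] at this
    omega
  · intro x hx j hj
    obtain ⟨v, hv, w, hw, rfl⟩ := Submodule.mem_sup.mp hx
    simp only [Finset.mem_union, not_or] at hj
    simp [hV2 v hv j hj.1, hW2 w hw j hj.2]
  · intro x hx y hy
    obtain ⟨v, hv, w, hw, rfl⟩ := Submodule.mem_sup.mp hx
    obtain ⟨v', hv', w', hw', rfl⟩ := Submodule.mem_sup.mp hy
    have h1 : ∀ j, d j * (star ((v + w) j) * (v' + w') j)
        = d j * (star (v j) * v' j) + d j * (star (w j) * w' j) := by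
      intro j
      have ha : star (v j) * w' j = 0 := by
        rcases hcross v hv w' hw' j with h | h <;> simp [h]
      have hb : star (w j) * v' j = 0 := by
        rcases hcross v' hv' w hw j with h | h <;> simp [h]
      simp only [Pi.add_apply, star_add]
      linear_combination d j * ha + d j * hb
    simp only [h1, Finset.sum_add_distrib, hV3 v hv v' hv', hW3 w hw w' hw', add_zero]

lemma HasIsotropic.biUnion [DecidableEq ι] {κ : Type*} [DecidableEq κ] (I : Finset κ)
    (S : κ → Finset ι) (k : κ → ℕ) (h : ∀ i ∈ I, HasIsotropic d (S i) (k i))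
    (hS : (I : Set κ).PairwiseDisjoint S) : HasIsotropic d (I.biUnion S) (∑ i ∈ I, k i) := by
  induction I using Finset.induction_on with
  | empty => simpa using HasIsotropic.zero _
  | insert a I ha ih =>
    rw [Finset.biUnion_insert, Finset.sum_insert ha]
    refine (h a (Finset.mem_insert_self a I)).union
      (ih (fun i hi => h i (Finset.mem_insert_of_mem hi))
        (hS.subset (by simp))) ?_
    rw [Finset.disjoint_biUnion_right]
    intro i hi
    exact hS (by simp) (by simp [hi]) (by rintro rfl; exact ha hi)

lemma hasIsotropic_one {S : Finset ι} {x : ι → ℂ} (hx : x ≠ 0) (hxS : ∀ j ∉ S, x j = 0)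
    (h : ∑ j, d j * (star (x j) * x j) = 0) : HasIsotropic d S 1 := by
  refine ⟨Submodule.span ℂ {x}, (finrank_span_singleton hx).ge, ?_, ?_⟩
  · intro y hy j hj
    obtain ⟨a, rfl⟩ := Submodule.mem_span_singleton.mp hy
    simp [hxS j hj]
  · intro y hy z hz
    obtain ⟨a, rfl⟩ := Submodule.mem_span_singleton.mp hy
    obtain ⟨b, rfl⟩ := Submodule.mem_span_singleton.mp hz
    calc _ = star a * b * ∑ j, d j * (star (x j) * x j) := by
          rw [Finset.mul_sum]
          refine Finset.sum_congr rfl fun j _ => ?_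
          simp only [Pi.smul_apply, smul_eq_mul, star_mul']
          ring
      _ = 0 := by rw [h, mul_zero]

lemma hasIsotropic_singleton {i : ι} (hi : d i = 0) : HasIsotropic d {i} 1 := by
  classical
  refine hasIsotropic_one (x := Pi.single i 1) (by simp) ?_ ?_
  · intro j hj
    simp only [Finset.mem_singleton] at hj
    simp [hj]
  · refine Finset.sum_eq_zero fun j _ => ?_
    by_cases hj : j = i
    · simp [hj, hi]
    · simp [hj]

lemma hasIsotropic_pair [DecidableEq ι] {i j : ι} (hij : i ≠ j) {c : ℝ} (hc : 0 ≤ c)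
    (h : d i = -(c * d j)) : HasIsotropic d {i, j} 1 := by
  refine hasIsotropic_one (x := Pi.single i 1 + Pi.single j (Real.sqrt c : ℂ)) ?_ ?_ ?_
  · intro h0
    have := congrFun h0 i
    simp [hij] at this
  · intro l hl
    simp only [Finset.mem_insert, Finset.mem_singleton, not_or] at hl
    simp [hl.1, hl.2]
  · rw [Finset.sum_eq_add i j hij]
    · have hs : (Real.sqrt c : ℂ) * Real.sqrt c = c := by
        rw [← Complex.ofReal_mul, Real.mul_self_sqrt hc]
      simp [hij, hij.symm, h, hs]
      ring
    · intro l _ hl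
      simp [hl.1, hl.2]
    · simp
    · simp

/-- Nodes `t j` and weights whose signs agree with those of the Lagrange nodal weights: the form is
isotropic on (rescaled) polynomials of degree less than `q`, by the vanishing of the divided
differences of order `2 * q` on polynomials of degree less than `2 * q`. -/
lemma hasIsotropic_of_nodes [DecidableEq ι] {G : Finset ι} {q : ℕ} (hG : G.card = 2 * q + 1)
    {t a : ι → ℝ} (ht : Set.InjOn t G) (c : ℂ)
    (hd : ∀ j ∈ G, d j = c * (a j * (1 + Complex.I * t j)))
    (ha : ∀ j ∈ G, a j * ∏ l ∈ G.erase j, (t j - t l) < 0) : HasIsotropic d G q := by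
  set w : ι → ℝ := fun j => -(a j * ∏ l ∈ G.erase j, (t j - t l)) with hw
  have hwpos : ∀ j ∈ G, 0 < w j := fun j hj => by simpa [hw] using ha j hj
  have htC : Set.InjOn (fun j => (t j : ℂ)) G := fun x hx y hy h =>
    ht hx hy (Complex.ofReal_injective h)
  let Φ : Polynomial.degreeLT ℂ q →ₗ[ℂ] (ι → ℂ) :=
    { toFun := fun p j => if j ∈ G then
        ((Real.sqrt (w j))⁻¹ : ℝ) * (p : Polynomial ℂ).eval (t j : ℂ) else 0
      map_add' := by
        intro p r
        funext j
        by_cases hj : j ∈ G <;> simp [hj, mul_add]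
      map_smul' := by
        intro b p
        funext j
        by_cases hj : j ∈ G <;> simp [hj, mul_left_comm] }
  have hΦ : ∀ p j, Φ p j = if j ∈ G then
        ((Real.sqrt (w j))⁻¹ : ℝ) * (p : Polynomial ℂ).eval (t j : ℂ) else 0 := fun _ _ => rfl
  have hinj : Function.Injective Φ := by
    rw [← LinearMap.ker_eq_bot, LinearMap.ker_eq_bot']
    intro p hp
    apply Subtype.ext
    refine Polynomial.eq_zero_of_degree_lt_of_eval_index_eq_zero G htC ?_ ?_
    · refine (Polynomial.mem_degreeLT.mp p.2).trans_le ?_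
      rw [hG]
      exact_mod_cast (by omega : q ≤ 2 * q + 1)
    · intro j hj
      have := congrFun hp j
      rw [hΦ, if_pos hj] at this
      refine (mul_eq_zero.mp this).resolve_left ?_
      exact_mod_cast (inv_pos.mpr (Real.sqrt_pos.mpr (hwpos j hj))).ne'
  refine ⟨LinearMap.range Φ, ?_, ?_, ?_⟩
  · rw [LinearMap.finrank_range_of_inj hinj, (Polynomial.degreeLTEquiv ℂ q).finrank_eq]
    simp
  · rintro _ ⟨p, rfl⟩ j hj
    simp [hΦ, hj]
  · rintro _ ⟨p, rfl⟩ _ ⟨r, rfl⟩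
    set P : Polynomial ℂ := (1 + Polynomial.C Complex.I * Polynomial.X) *
      ((p : Polynomial ℂ).map (starRingEnd ℂ) * (r : Polynomial ℂ)) with hP
    have hdeg : P.natDegree < 2 * q ∨ P = 0 := by
      by_cases hp0 : (p : Polynomial ℂ) = 0
      · right; simp [hP, hp0]
      by_cases hr0 : (r : Polynomial ℂ) = 0
      · right; simp [hP, hr0]
      left
      have h1 := (Polynomial.natDegree_lt_iff_degree_lt hp0).mpr (Polynomial.mem_degreeLT.mp p.2)
      have h2 := (Polynomial.natDegree_lt_iff_degree_lt hr0).mpr (Polynomial.mem_degreeLT.mp r.2)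
      have h3 : (1 + Polynomial.C Complex.I * Polynomial.X : Polynomial ℂ).natDegree ≤ 1 := by
        compute_degree
      have h4 : ((p : Polynomial ℂ).map (starRingEnd ℂ)).natDegree
          ≤ (p : Polynomial ℂ).natDegree := Polynomial.natDegree_map_le
      have h5 := Polynomial.natDegree_mul_le (p := (p : Polynomial ℂ).map (starRingEnd ℂ))
        (q := (r : Polynomial ℂ))
      have h6 := Polynomial.natDegree_mul_le
        (p := (1 + Polynomial.C Complex.I * Polynomial.X : Polynomial ℂ))
        (q := (p : Polynomial ℂ).map (starRingEnd ℂ) * (r : Polynomial ℂ))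
      rw [← hP] at h6
      omega
    have hdeg' : P.degree < G.card := by
      rcases hdeg with h | h
      · refine Polynomial.degree_le_natDegree.trans_lt ?_
        rw [hG]
        exact_mod_cast (by omega)
      · rw [h, Polynomial.degree_zero]
        exact WithBot.bot_lt_coe _
    have hcoeff : P.coeff (G.card - 1) = 0 := by
      rcases hdeg with h | h
      · exact Polynomial.coeff_eq_zero_of_natDegree_lt (by omega)
      · simp [h]
    rw [Lagrange.coeff_eq_sum htC hdeg'] at hcoeff
    have hstep : ∀ j ∈ G, d j * (star (Φ p j) * Φ r j) =
        -c * (P.eval (t j : ℂ) / ∏ l ∈ G.erase j, ((t j : ℂ) - t l)) := by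
      intro j hj
      have hwj := hwpos j hj
      have hs : ((Real.sqrt (w j))⁻¹ : ℝ) * ((Real.sqrt (w j))⁻¹ : ℝ) = (w j)⁻¹ := by
        rw [← mul_inv, Real.mul_self_sqrt hwj.le]
      have hprod : (∏ l ∈ G.erase j, ((t j : ℂ) - t l))
          = ((∏ l ∈ G.erase j, (t j - t l) : ℝ) : ℂ) := by push_cast; rfl
      have hpc : ((p : Polynomial ℂ).map (starRingEnd ℂ)).eval (t j : ℂ)
          = star ((p : Polynomial ℂ).eval (t j : ℂ)) := by
        have := Polynomial.eval_map_apply (f := starRingEnd ℂ) (p := (p : Polynomial ℂ)) (t j : ℂ)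
        simpa using this
      have haj : (a j : ℂ) ≠ 0 := by
        have : a j ≠ 0 := fun h => by simp [hw, h] at hwj
        exact_mod_cast this
      have hQ : ((∏ l ∈ G.erase j, (t j - t l) : ℝ) : ℂ) ≠ 0 := by
        have : (∏ l ∈ G.erase j, (t j - t l) : ℝ) ≠ 0 := fun h => by simp [hw, h] at hwj
        exact_mod_cast this
      rw [hΦ, hΦ, if_pos hj, if_pos hj, hprod, hd j hj, hP]
      simp only [Polynomial.eval_mul, Polynomial.eval_add, Polynomial.eval_one, Polynomial.eval_C,
        Polynomial.eval_X, hpc, star_mul', Complex.star_def, Complex.conj_ofReal]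
      have hs' : (((Real.sqrt (w j))⁻¹ : ℝ) : ℂ) * (((Real.sqrt (w j))⁻¹ : ℝ) : ℂ)
          = -((a j : ℂ) * ((∏ l ∈ G.erase j, (t j - t l) : ℝ) : ℂ))⁻¹ := by
        rw [← Complex.ofReal_mul, hs, hw]
        push_cast
        rw [inv_neg]
      generalize (((Real.sqrt (w j))⁻¹ : ℝ) : ℂ) = s at *
      generalize ((∏ l ∈ G.erase j, (t j - t l) : ℝ) : ℂ) = Q at *
      generalize (starRingEnd ℂ) ((p : Polynomial ℂ).eval (t j : ℂ)) = x
      generalize (r : Polynomial ℂ).eval (t j : ℂ) = y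
      calc _ = c * (a j * (1 + Complex.I * t j)) * (x * y) * (s * s) := by ring
        _ = _ := by rw [hs']; field_simp
    rw [← Finset.sum_subset (Finset.subset_univ G) (fun j _ hj => by simp [hΦ, hj]),
      Finset.sum_congr rfl hstep, ← Finset.mul_sum, hcoeff, mul_zero]

end Isotropic

section HalfPlanes

variable {ι : Type*} {d : ι → ℂ}

/-- The points `d j`, `j ∈ S`, that lie in the closed half-plane with (conjugated) normal `u`. -/
noncomputable def closedHalf (d : ι → ℂ) (S : Finset ι) (u : ℂ) : Finset ι :=
  S.filter fun j => 0 ≤ (u * d j).re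

/-- Tilting the half-plane with normal `u` slightly towards `v`. -/
lemma le_card_tilt {S : Finset ι} {k : ℕ} (h : ∀ u ≠ 0, k ≤ (closedHalf d S u).card)
    {u : ℂ} (hu : u ≠ 0) (v : ℂ) :
    k ≤ (S.filter fun j =>
      0 < (u * d j).re ∨ ((u * d j).re = 0 ∧ 0 ≤ (v * d j).re)).card := by
  have key : ∀ᶠ ε : ℝ in nhdsWithin 0 (Set.Ioi 0), u + ε * v ≠ 0 ∧ ∀ j ∈ S,
      0 ≤ ((u + ε * v) * d j).re →
        0 < (u * d j).re ∨ ((u * d j).re = 0 ∧ 0 ≤ (v * d j).re) := by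
    refine Filter.Eventually.and ?_ ((Filter.eventually_all_finset S).mpr ?_)
    · have hc : Continuous fun ε : ℝ => u + ε * v := by fun_prop
      exact ((hc.tendsto' 0 u (by simp)).eventually_ne hu).filter_mono nhdsWithin_le_nhds
    · intro j _
      have hexp : ∀ ε : ℝ, ((u + ε * v) * d j).re = (u * d j).re + ε * (v * d j).re := by
        intro ε
        rw [add_mul, mul_assoc, Complex.add_re, Complex.re_ofReal_mul]
      rcases lt_trichotomy (u * d j).re 0 with hj | hj | hj
      · have hc : Continuous fun ε : ℝ => (u * d j).re + ε * (v * d j).re := by fun_prop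
        have := ((hc.tendsto' 0 _ (by simp)).eventually_lt_const hj).filter_mono
          (nhdsWithin_le_nhds (s := Set.Ioi 0))
        filter_upwards [this] with ε hε h0
        rw [hexp] at h0
        exact absurd h0 (not_le.mpr hε)
      · filter_upwards [self_mem_nhdsWithin] with ε hε h0
        rw [hexp, hj, zero_add] at h0
        exact Or.inr ⟨hj, nonneg_of_mul_nonneg_right h0 hε⟩
      · exact Filter.Eventually.of_forall fun _ _ => Or.inl hj
  obtain ⟨ε, hε, hS⟩ := key.exists
  refine (h _ hε).trans (Finset.card_le_card fun j hj => ?_)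
  rw [closedHalf, Finset.mem_filter] at hj
  exact Finset.mem_filter.mpr ⟨hj.1, hS j hj.1 hj.2⟩

lemma le_card_closedHalf_erase_zero [DecidableEq ι] {S : Finset ι} {k : ℕ}
    (h : ∀ u ≠ 0, k + 1 ≤ (closedHalf d S u).card) {i : ι} :
    ∀ u ≠ 0, k ≤ (closedHalf d (S.erase i) u).card := by
  intro u hu
  have h1 : closedHalf d (S.erase i) u = (closedHalf d S u).erase i := by
    rw [closedHalf, closedHalf, Finset.filter_erase]
  have := h u hu
  have := Finset.pred_card_le_card_erase (s := closedHalf d S u) (a := i)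
  rw [h1]
  omega

lemma le_card_closedHalf_erase_pair [DecidableEq ι] {S : Finset ι} {k : ℕ}
    (h : ∀ u ≠ 0, k + 1 ≤ (closedHalf d S u).card) {i j : ι} (hi : d i ≠ 0)
    (hjS : j ∈ S) {c : ℝ} (hc : 0 < c) (hij : d j = -(c * d i)) :
    ∀ u ≠ 0, k ≤ (closedHalf d ((S.erase i).erase j) u).card := by
  intro u hu
  have h1 : closedHalf d ((S.erase i).erase j) u = ((closedHalf d S u).erase i).erase j := by
    rw [closedHalf, closedHalf, Finset.filter_erase, Finset.filter_erase]
  have h2 := h u hu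
  have h3 := Finset.pred_card_le_card_erase (s := closedHalf d S u) (a := i)
  have h4 := Finset.pred_card_le_card_erase (s := (closedHalf d S u).erase i) (a := j)
  have hre : ∀ w : ℂ, (w * d j).re = -(c * (w * d i).re) := by
    intro w
    rw [hij, ← Complex.re_ofReal_mul, ← Complex.neg_re]
    congr 1
    ring
  rw [h1]
  rcases lt_trichotomy (u * d i).re 0 with h0 | h0 | h0
  · have : i ∉ closedHalf d S u := fun hmem => absurd (Finset.mem_filter.mp hmem).2 (not_le.mpr h0)
    rw [Finset.erase_eq_of_notMem this] at h4 ⊢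
    omega
  · have htilt := le_card_tilt h hu (starRingEnd ℂ (d i))
    have hlt : (S.filter fun l =>
        0 < (u * d l).re ∨ ((u * d l).re = 0 ∧ 0 ≤ (starRingEnd ℂ (d i) * d l).re)).card
        < (closedHalf d S u).card := by
      refine Finset.card_lt_card (Finset.ssubset_iff_subset_ne.mpr ⟨?_, ?_⟩)
      · intro l hl
        rw [Finset.mem_filter] at hl
        exact Finset.mem_filter.mpr ⟨hl.1, by rcases hl.2 with h | h <;> linarith [h]⟩
      · intro heq
        have hj : j ∈ closedHalf d S u :=
          Finset.mem_filter.mpr ⟨hjS, by rw [hre, h0]; simp⟩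
        rw [← heq, Finset.mem_filter, hre, hre, h0] at hj
        have hpos : 0 < (starRingEnd ℂ (d i) * d i).re := by
          rw [← Complex.normSq_eq_conj_mul_self, Complex.ofReal_re]
          exact Complex.normSq_pos.mpr hi
        rcases hj.2 with h | h
        · simp at h
        · nlinarith [h.2, mul_pos hc hpos]
    omega
  · have : j ∉ (closedHalf d S u).erase i := by
      intro hmem
      have hj := (Finset.mem_filter.mp (Finset.mem_of_mem_erase hmem)).2
      rw [hre] at hj
      linarith [mul_pos hc h0]
    rw [Finset.erase_eq_of_notMem this]
    omega

/-- Without zeros and antipodal pairs, open half-planes contain as many points as closed ones. -/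
lemma le_card_open {S : Finset ι} {k : ℕ} (h : ∀ u ≠ 0, k ≤ (closedHalf d S u).card)
    (h0 : ∀ i ∈ S, d i ≠ 0)
    (hanti : ∀ i ∈ S, ∀ j ∈ S, ∀ c : ℝ, 0 < c → d j ≠ -(c * d i)) {u : ℂ} (hu : u ≠ 0) :
    k ≤ (S.filter fun j => 0 < (u * d j).re).card := by
  by_cases hb : ∃ i ∈ S, (u * d i).re = 0
  · obtain ⟨i, hi, hui⟩ := hb
    refine (le_card_tilt h hu (-(starRingEnd ℂ (d i)))).trans (Finset.card_le_card ?_)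
    intro j hj
    rw [Finset.mem_filter] at hj ⊢
    refine ⟨hj.1, hj.2.resolve_right ?_⟩
    rintro ⟨huj, hij⟩
    have hpos : 0 < Complex.normSq (d i) := Complex.normSq_pos.mpr (h0 i hi)
    -- both points lie on the line orthogonal to `u`
    have him : (starRingEnd ℂ (d i) * d j).im = 0 := by
      have hpu : 0 < Complex.normSq u := Complex.normSq_pos.mpr hu
      have hprod : starRingEnd ℂ (u * d i) * (u * d j)
          = (Complex.normSq u : ℂ) * (starRingEnd ℂ (d i) * d j) := by
        rw [map_mul, Complex.normSq_eq_conj_mul_self]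
        ring
      have := congrArg Complex.im hprod
      rw [Complex.im_ofReal_mul, Complex.mul_im, Complex.conj_re, Complex.conj_im, hui, huj] at this
      simp only [zero_mul, mul_zero, add_zero] at this
      exact (mul_eq_zero.mp this.symm).resolve_left hpu.ne'
    have hreal : starRingEnd ℂ (d i) * d j = ((starRingEnd ℂ (d i) * d j).re : ℂ) :=
      Complex.ext (by simp) (by simpa using him)
    set x := (starRingEnd ℂ (d i) * d j).re with hx
    have hx0 : x ≤ 0 := by
      rw [neg_mul, Complex.neg_re] at hij
      linarith
    have hdj : d j = ((x / Complex.normSq (d i) : ℝ) : ℂ) * d i := by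
      have hn : (Complex.normSq (d i) : ℂ) ≠ 0 := by exact_mod_cast hpos.ne'
      rw [Complex.ofReal_div, ← hreal, div_mul_eq_mul_div, eq_div_iff hn,
        Complex.normSq_eq_conj_mul_self]
      ring
    have hxne : x ≠ 0 := by
      intro hx'
      refine h0 j hj.1 ?_
      rw [hdj, hx']
      simp
    refine hanti i hi j hj.1 (-(x / Complex.normSq (d i))) ?_ ?_
    · rw [neg_pos]
      exact div_neg_of_neg_of_pos (lt_of_le_of_ne hx0 hxne) hpos
    · rw [Complex.ofReal_neg, neg_mul, neg_neg]
      exact hdj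
  · push Not at hb
    refine (h u hu).trans (Finset.card_le_card fun j hj => ?_)
    rw [closedHalf, Finset.mem_filter] at hj
    exact Finset.mem_filter.mpr ⟨hj.1, lt_of_le_of_ne hj.2 (hb j hj.1).symm⟩

end HalfPlanes

section Levels

lemma exists_monotone_enum {ι : Type*} [DecidableEq ι] {S : Finset ι} (hS : S.Nonempty)
    (t : ι → ℝ) : ∃ e : ℕ → ι, Set.InjOn e (Finset.range S.card) ∧
      (Finset.range S.card).image e = S ∧ ∀ i j, i ≤ j → j < S.card → t (e i) ≤ t (e j) := by
  let f : Fin S.card ≃ S := S.equivFin.symm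
  let σ := Tuple.sort fun i => t (f i)
  have hσ : Monotone ((fun i => t (f i)) ∘ σ) := Tuple.monotone_sort _
  let e : ℕ → ι := fun i => if h : i < S.card then (f (σ ⟨i, h⟩) : ι) else hS.choose
  have he : ∀ i (h : i < S.card), e i = f (σ ⟨i, h⟩) := fun i h => dif_pos h
  have hinj : Set.InjOn e (Finset.range S.card) := by
    intro i hi j hj hij
    simp only [Finset.coe_range, Set.mem_Iio] at hi hj
    rw [he i hi, he j hj] at hij
    have := σ.injective (f.injective (Subtype.ext hij))
    simpa using this
  refine ⟨e, hinj, ?_, ?_⟩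
  · refine Finset.eq_of_subset_of_card_le ?_ ?_
    · intro x hx
      obtain ⟨i, hi, rfl⟩ := Finset.mem_image.mp hx
      rw [he i (Finset.mem_range.mp hi)]
      exact (f _).2
    · rw [Finset.card_image_of_injOn hinj, Finset.card_range]
  · intro i j hij hj
    rw [he i (hij.trans_lt hj), he j hj]
    exact hσ (show (⟨i, _⟩ : Fin S.card) ≤ ⟨j, hj⟩ from hij)

variable {s : ℕ → ℤ}

/-- The lattice path with steps `s`. -/
def path (s : ℕ → ℤ) (i : ℕ) : ℤ := ∑ l ∈ Finset.range i, s l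

/-- The depth of the unit interval crossed by the `i`-th step of the path. -/
def pathLevel (s : ℕ → ℤ) (i : ℕ) : ℕ := (-(max (path s i) (path s (i + 1)))).toNat

lemma path_succ (i : ℕ) : path s (i + 1) = path s i + s i := Finset.sum_range_succ _ _

/-- The signed number of crossings of a level after time `i`. -/
lemma sum_level_Ico {m : ℕ} (hs : ∀ i, s i = 1 ∨ s i = -1) (hle : ∀ i ≤ m, path s i ≤ 0)
    (ℓ : ℕ) {i : ℕ} (him : i ≤ m) :
    ∑ l ∈ (Finset.Ico i m).filter (fun l => pathLevel s l = ℓ), s l =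
      (if path s i ≤ -ℓ - 1 then 1 else 0) - (if path s m ≤ -ℓ - 1 then 1 else 0) := by
  induction him using Nat.decreasingInduction with
  | self => simp
  | of_succ i hi ih =>
    have h1 := hle i hi.le
    have h2 := hle (i + 1) hi
    rw [← Finset.insert_Ico_add_one_left_eq_Ico hi, Finset.filter_insert]
    have h3 := path_succ (s := s) i
    have h4 := hs i
    split_ifs with h5
    all_goals
      first
      | rw [Finset.sum_insert (by simp), ih]
      | rw [ih]
      unfold pathLevel at h5
      split_ifs <;> omega

lemma sum_parity {T : Finset ℕ} (hs : ∀ i, s i = 1 ∨ s i = -1) :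
    Even (∑ l ∈ T, s l + T.card) := by
  have : ∑ l ∈ T, s l + (T.card : ℤ) = ∑ l ∈ T, (s l + 1) := by
    rw [Finset.sum_add_distrib]; simp
  rw [this]
  refine Finset.even_sum _ fun l _ => ?_
  rcases hs l with h | h <;> rw [h] <;> decide

lemma path_add_of_const {i n : ℕ} (h : ∀ l, i ≤ l → l < i + n → s l = s i) :
    path s (i + n) = path s i + n * s i := by
  induction n with
  | zero => simp
  | succ n ih =>
    rw [← add_assoc, path_succ, ih fun l h1 h2 => h l h1 (by omega),
      h (i + n) (by omega) (by omega)]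
    push_cast
    ring

lemma pathLevel_ne_of_const {i j : ℕ} (hij : i < j) (hs : s i = 1 ∨ s i = -1)
    (h : ∀ l, i ≤ l → l ≤ j → s l = s i) (hi : path s i ≤ 0)
    (hj' : path s (j + 1) ≤ 0) :
    pathLevel s i ≠ pathLevel s j := by
  have h1 := path_succ (s := s) i
  have h2 := path_succ (s := s) j
  have h3 := h j hij.le le_rfl
  have h4 := path_add_of_const (s := s) (i := i) (n := j - i)
    fun l h1 h2 => h l h1 (by omega)
  have h5 : i + (j - i) = j := by omega
  rw [h5] at h4
  unfold pathLevel
  rcases hs with hs | hs <;> rw [hs] at h3 h4 h1 <;> rw [h3] at h2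
  · rw [max_eq_right (by omega), max_eq_right (by omega)]
    omega
  · rw [max_eq_left (by omega), max_eq_left (by omega)]
    omega

lemma prod_sub_sign {T : Finset ℕ} {x : ℕ → ℝ} {i : ℕ} (hmono : ∀ l ∈ T, l < i → x l < x i)
    (hmono' : ∀ l ∈ T, i < l → x i < x l) :
    0 < (-1 : ℝ) ^ (T.filter fun l => i < l).card * ∏ l ∈ T.erase i, (x i - x l) := by
  have hcard : ((-1 : ℝ) ^ (T.filter fun l => i < l).card)
      = ∏ l ∈ T.erase i, if i < l then (-1 : ℝ) else 1 := by
    rw [Finset.prod_ite, Finset.prod_const, Finset.prod_const_one, mul_one]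
    congr 2
    ext l
    simp only [Finset.mem_filter, Finset.mem_erase]
    constructor
    · exact fun h => ⟨⟨by omega, h.1⟩, h.2⟩
    · exact fun h => ⟨h.1.2, h.2⟩
  rw [hcard, ← Finset.prod_mul_distrib]
  refine Finset.prod_pos fun l hl => ?_
  obtain ⟨hne, hl⟩ := Finset.mem_erase.mp hl
  rcases lt_or_gt_of_ne hne with h | h
  · rw [if_neg (by omega)]
    linarith [hmono l hl h]
  · rw [if_pos h]
    linarith [hmono' l hl h]

end Levels

section Assembly

variable {ι : Type*} [Fintype ι] [DecidableEq ι] {d : ι → ℂ}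

/-- Balanced configurations: the `2k + r` points are sorted by slope and split, according to the
level of the associated lattice path, into `r` groups with alternating signs. -/
lemma hasIsotropic_of_balanced {S : Finset ι} {k : ℕ} {a t : ι → ℝ} {c : ℂ}
    (hd : ∀ j ∈ S, d j = c * (a j * (1 + Complex.I * t j))) (ha : ∀ j ∈ S, a j ≠ 0)
    (hties : ∀ i ∈ S, ∀ j ∈ S, t i = t j → 0 < a i * a j)
    (hk : (S.filter fun j => 0 < a j).card = k)
    (hpos : ∀ τ : ℝ, k ≤ (S.filter fun j => 0 < a j * (τ - t j)).card)
    (hneg : ∀ τ : ℝ, k ≤ (S.filter fun j => a j * (τ - t j) < 0).card) :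
    HasIsotropic d S k := by
  rcases S.eq_empty_or_nonempty with rfl | hS
  · simp only [Finset.filter_empty, Finset.card_empty] at hk
    exact hk ▸ HasIsotropic.zero _
  obtain ⟨e, he, heS, hmono⟩ := exists_monotone_enum hS t
  set m := S.card with hm
  have hmem : ∀ i < m, e i ∈ S := fun i hi =>
    heS ▸ Finset.mem_image_of_mem e (Finset.mem_range.mpr hi)
  have hcard : ∀ (p : ι → Prop) [DecidablePred p],
      ((S.filter p).card : ℤ) = ∑ i ∈ Finset.range m, if p (e i) then 1 else 0 := by
    intro p _
    conv_lhs => rw [← heS]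
    rw [Finset.card_filter, Finset.sum_image he]
    push_cast
    rfl
  set s : ℕ → ℤ := fun i => if 0 < a (e i) then 1 else -1 with hs_def
  have hs : ∀ i, s i = 1 ∨ s i = -1 := by
    intro i
    by_cases h : 0 < a (e i) <;> simp [hs_def, h]
  have hs_pos : ∀ i, s i = 1 → 0 < a (e i) := by
    intro i hi
    by_contra h
    simp [hs_def, h] at hi
  have hs_neg : ∀ i < m, s i = -1 → a (e i) < 0 := by
    intro i him hi
    refine lt_of_le_of_ne (not_lt.mp fun h => ?_) (ha _ (hmem i him))
    simp [hs_def, h] at hi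
  have hend : path s m = 2 * k - m := by
    have h1 := hcard fun j => 0 < a j
    rw [hk] at h1
    rw [h1, path, Finset.mul_sum]
    have : (m : ℤ) = ∑ _i ∈ Finset.range m, (1 : ℤ) := by simp
    conv_rhs => rw [this]
    rw [← Finset.sum_sub_distrib]
    refine Finset.sum_congr rfl fun i _ => ?_
    simp only [hs_def]
    split_ifs <;> norm_num
  have hcount : ∀ i ≤ m, ∀ (p : ι → Prop) [DecidablePred p] (σ : ℤ), σ = 1 ∨ σ = -1 →
      (∀ l < m, p (e l) → s l = if l < i then -σ else σ) → k ≤ (S.filter p).card →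
      2 * (k : ℤ) ≤ m + σ * (path s m - 2 * path s i) := by
    intro i him p _ σ hσ hp hkp
    have h1 : (k : ℤ) ≤ (S.filter p).card := by exact_mod_cast hkp
    rw [hcard] at h1
    have h2 : ∑ l ∈ Finset.range m, (2 * (if p (e l) then 1 else 0) : ℤ)
        ≤ ∑ l ∈ Finset.range m, (1 + σ * (s l - 2 * if l < i then s l else 0)) := by
      refine Finset.sum_le_sum fun l hl => ?_
      by_cases hpl : p (e l)
      · have h3 := hp l (Finset.mem_range.mp hl) hpl
        rw [if_pos hpl]
        split_ifs at h3 ⊢ <;> rcases hσ with rfl | rfl <;> rw [h3] <;> norm_num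
      · rw [if_neg hpl]
        split_ifs <;> rcases hs l with h | h <;> rcases hσ with rfl | rfl <;> rw [h] <;> norm_num
    have h4 : ∑ l ∈ Finset.range m, (if l < i then s l else 0) = path s i := by
      rw [← Finset.sum_filter, path]
      congr 1
      ext l
      simp only [Finset.mem_filter, Finset.mem_range]
      omega
    rw [← Finset.mul_sum, Finset.sum_add_distrib, ← Finset.mul_sum, Finset.sum_sub_distrib,
      ← Finset.mul_sum, h4] at h2
    simp only [Finset.sum_const, Finset.card_range, nsmul_eq_mul, mul_one] at h2
    rw [path]
    linarith
  have hle : ∀ i ≤ m, path s i ≤ 0 := by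
    intro i him
    rcases Nat.eq_zero_or_pos i with rfl | hi
    · simp [path]
    have := hcount i him (fun j => a j * (t (e (i - 1)) - t j) < 0) 1 (Or.inl rfl) ?_ (hneg _)
    · rw [hend] at this
      linarith
    · intro l hl hlt
      split_ifs with hli
      · have h1 := hmono l (i - 1) (by omega) (by omega)
        refine (hs l).resolve_left fun h => ?_
        nlinarith [hs_pos l h]
      · have h1 := hmono (i - 1) l (by omega) hl
        refine (hs l).resolve_right fun h => ?_
        nlinarith [hs_neg l hl h]
  have hge : ∀ i ≤ m, path s m ≤ path s i := by
    intro i him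
    rcases him.eq_or_lt with rfl | hi
    · exact le_rfl
    have := hcount i him (fun j => 0 < a j * (t (e i) - t j)) (-1) (Or.inr rfl) ?_ (hpos _)
    · rw [hend] at this ⊢
      linarith
    · intro l hl hlt
      split_ifs with hli
      · have h1 := hmono l i (by omega) (by omega)
        rw [neg_neg]
        refine (hs l).resolve_right fun h => ?_
        nlinarith [hs_neg l hl h]
      · have h1 := hmono i l (by omega) hl
        refine (hs l).resolve_left fun h => ?_
        nlinarith [hs_pos l h]
  obtain ⟨r, hr⟩ : ∃ r : ℕ, path s m = -r := ⟨(-path s m).toNat, by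
    have := hle m le_rfl
    omega⟩
  have hlevel : ∀ i ∈ Finset.range m, pathLevel s i ∈ Finset.range r := by
    intro i hi
    rw [Finset.mem_range] at hi ⊢
    have h1 := hle i hi.le
    have h2 := hle (i + 1) hi
    have h3 := hge i hi.le
    have h4 := hge (i + 1) hi
    have h5 := path_succ (s := s) i
    unfold pathLevel
    rcases hs i with h | h <;> rw [h] at h5
    · rw [max_eq_right (by omega)]
      omega
    · rw [max_eq_left (by omega)]
      omega
  set I : ℕ → Finset ℕ := fun ℓ => (Finset.range m).filter fun i => pathLevel s i = ℓ with hI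
  have hIsub : ∀ ℓ, I ℓ ⊆ Finset.range m := fun ℓ => Finset.filter_subset _ _
  have heI : ∀ ℓ, Set.InjOn e (I ℓ) := fun ℓ => he.mono (by exact_mod_cast hIsub ℓ)
  have hodd : ∀ ℓ ∈ Finset.range r, (I ℓ).card = 2 * ((I ℓ).card / 2) + 1 := by
    intro ℓ hℓ
    rw [Finset.mem_range] at hℓ
    have h1 := sum_level_Ico (s := s) hs hle ℓ (Nat.zero_le m)
    rw [← Finset.range_eq_Ico, if_neg (by simp [path]; omega), if_pos (by omega)] at h1
    have h2 := sum_parity (s := s) (T := I ℓ) hs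
    rw [h1] at h2
    obtain ⟨x, hx⟩ := h2
    omega
  have htI : ∀ ℓ, ∀ i ∈ I ℓ, ∀ j ∈ I ℓ, i < j → t (e i) < t (e j) := by
    intro ℓ i hi j hj hij
    rw [hI, Finset.mem_filter, Finset.mem_range] at hi hj
    refine lt_of_le_of_ne (hmono i j hij.le hj.1) fun heq => ?_
    refine pathLevel_ne_of_const hij (hs i) ?_ (hle i hi.1.le) (hle (j + 1) hj.1)
      (hi.2.trans hj.2.symm)
    intro l hil hlj
    have h1 : t (e i) = t (e l) := le_antisymm (hmono i l hil (hlj.trans_lt hj.1))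
      (heq ▸ hmono l j hlj hj.1)
    have h2 := hties _ (hmem i hi.1) _ (hmem l (hlj.trans_lt hj.1)) h1
    rcases hs i with h | h
    · have h3 := hs_pos i h
      rw [h]
      refine (hs l).resolve_right fun h' => ?_
      nlinarith [hs_neg l (hlj.trans_lt hj.1) h']
    · have h3 := hs_neg i hi.1 h
      rw [h]
      refine (hs l).resolve_left fun h' => ?_
      nlinarith [hs_pos l h']
  have hgroup : ∀ ℓ ∈ Finset.range r, HasIsotropic d ((I ℓ).image e) ((I ℓ).card / 2) := by
    intro ℓ hℓ
    refine hasIsotropic_of_nodes (t := t) (a := a) (c := c) ?_ ?_ ?_ ?_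
    · rw [Finset.card_image_of_injOn (heI ℓ)]
      exact hodd ℓ hℓ
    · rw [Finset.coe_image]
      rintro _ ⟨i, hi, rfl⟩ _ ⟨j, hj, rfl⟩ hij
      rcases lt_trichotomy i j with h | h | h
      · exact absurd hij (htI ℓ i hi j hj h).ne
      · rw [h]
      · exact absurd hij (htI ℓ j hj i hi h).ne'
    · intro j hj
      obtain ⟨i, hi, rfl⟩ := Finset.mem_image.mp hj
      exact hd _ (hmem i (Finset.mem_range.mp (hIsub ℓ hi)))
    · intro j hj
      obtain ⟨i, hi, rfl⟩ := Finset.mem_image.mp hj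
      have him := Finset.mem_range.mp (hIsub ℓ hi)
      have herase : ((I ℓ).image e).erase (e i) = ((I ℓ).erase i).image e := by
        ext x
        simp only [Finset.mem_erase, Finset.mem_image]
        constructor
        · rintro ⟨hne, l, hl, rfl⟩
          exact ⟨l, ⟨fun h => hne (h ▸ rfl), hl⟩, rfl⟩
        · rintro ⟨l, ⟨hne, hl⟩, rfl⟩
          exact ⟨fun h => hne (heI ℓ hl hi h), l, hl, rfl⟩
      rw [herase, Finset.prod_image ((heI ℓ).mono (by simp))]
      have hsign := prod_sub_sign (T := I ℓ) (x := fun l => t (e l)) (i := i)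
        (fun l hl h => htI ℓ l hl i hi h) (fun l hl h => htI ℓ i hi l hl h)
      have h1 := sum_level_Ico (s := s) hs hle ℓ (i := i + 1) him
      rw [if_pos (c := path s m ≤ -ℓ - 1) (by rw [Finset.mem_range] at hℓ; omega)] at h1
      have h2 : (I ℓ).filter (fun l => i < l)
          = (Finset.Ico (i + 1) m).filter fun l => pathLevel s l = ℓ := by
        ext l
        simp only [hI, Finset.mem_filter, Finset.mem_range, Finset.mem_Ico]
        omega
      rw [h2] at hsign
      have h3 := sum_parity (s := s)
        (T := (Finset.Ico (i + 1) m).filter fun l => pathLevel s l = ℓ) hs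
      rw [h1] at h3
      have h4 := path_succ (s := s) i
      have h5 : pathLevel s i = ℓ := (Finset.mem_filter.mp hi).2
      have h6 := hle i him.le
      have h7 := hle (i + 1) him
      unfold pathLevel at h5
      rcases hs i with h | h <;> rw [h] at h4
      · rw [max_eq_right (by omega)] at h5
        rw [if_neg (by omega)] at h3
        have hodd' : Odd ((Finset.Ico (i + 1) m).filter fun l => pathLevel s l = ℓ).card := by
          obtain ⟨x, hx⟩ := h3
          exact ⟨x.toNat, by omega⟩
        rw [hodd'.neg_one_pow] at hsign
        nlinarith [hs_pos i h]
      · rw [max_eq_left (by omega)] at h5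
        rw [if_pos (by omega)] at h3
        have heven : Even ((Finset.Ico (i + 1) m).filter fun l => pathLevel s l = ℓ).card := by
          obtain ⟨x, hx⟩ := h3
          exact ⟨x.toNat, by omega⟩
        rw [heven.neg_one_pow] at hsign
        nlinarith [hs_neg i him h]
  have hunion := HasIsotropic.biUnion (Finset.range r) (fun ℓ => (I ℓ).image e)
    (fun ℓ => (I ℓ).card / 2) hgroup ?_
  · refine hunion.mono ?_ (le_of_eq ?_)
    · intro x hx
      obtain ⟨ℓ, -, hx⟩ := Finset.mem_biUnion.mp hx
      obtain ⟨i, hi, rfl⟩ := Finset.mem_image.mp hx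
      exact hmem i (Finset.mem_range.mp (hIsub ℓ hi))
    · have h1 := Finset.card_eq_sum_card_fiberwise hlevel
      rw [Finset.card_range] at h1
      have h2 : ∑ ℓ ∈ Finset.range r, (I ℓ).card
          = ∑ ℓ ∈ Finset.range r, (2 * ((I ℓ).card / 2) + 1) := Finset.sum_congr rfl hodd
      rw [← h1, Finset.sum_add_distrib, ← Finset.mul_sum] at h2
      simp only [Finset.sum_const, Finset.card_range, smul_eq_mul, mul_one] at h2
      omega
  · intro ℓ _ ℓ' _ hne
    rw [Function.onFun, Finset.disjoint_left]
    intro x hx hx'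
    obtain ⟨i, hi, rfl⟩ := Finset.mem_image.mp hx
    obtain ⟨j, hj, hij⟩ := Finset.mem_image.mp hx'
    have : j = i := he (by exact_mod_cast hIsub _ hj) (by exact_mod_cast hIsub _ hi) hij
    subst this
    exact hne ((Finset.mem_filter.mp hi).2.symm.trans (Finset.mem_filter.mp hj).2)

lemma hasIsotropic_of_no_antipodal {S : Finset ι} {k : ℕ}
    (h : ∀ u ≠ 0, k ≤ (closedHalf d S u).card) (h0 : ∀ i ∈ S, d i ≠ 0)
    (hanti : ∀ i ∈ S, ∀ j ∈ S, ∀ c : ℝ, 0 < c → d j ≠ -(c * d i)) : HasIsotropic d S k := by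
  obtain ⟨u, hu, hmin⟩ : ∃ u ≠ 0, ∀ w ≠ 0,
      (closedHalf d S u).card ≤ (closedHalf d S w).card := by
    obtain ⟨u, hu, hmin⟩ := exists_minimalFor_of_wellFoundedLT (fun w : ℂ => w ≠ 0)
      (fun w => (closedHalf d S w).card) ⟨1, one_ne_zero⟩
    exact ⟨u, hu, fun w hw => (le_total _ _).elim id fun hle => hmin hw hle⟩
  have hopen : ∀ w ≠ 0, (closedHalf d S u).card ≤ (S.filter fun j => 0 < (w * d j).re).card :=
    fun w hw => le_card_open hmin h0 hanti hw
  have hopen_eq : (S.filter fun j => 0 < (u * d j).re) = closedHalf d S u :=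
    Finset.eq_of_subset_of_card_le
      (Finset.monotone_filter_right S fun j _ hj => le_of_lt hj) (hopen u hu)
  have ha : ∀ j ∈ S, (u * d j).re ≠ 0 := by
    intro j hj hj0
    have : j ∈ closedHalf d S u := Finset.mem_filter.mpr ⟨hj, hj0.ge⟩
    rw [← hopen_eq, Finset.mem_filter] at this
    exact this.2.ne' hj0
  have hud : ∀ j ∈ S, u * d j = (u * d j).re * (1 + Complex.I *
      (((u * d j).im / (u * d j).re : ℝ) : ℂ)) := by
    intro j hj
    have := ha j hj
    apply Complex.ext <;> simp only [Complex.re_ofReal_mul, Complex.im_ofReal_mul, Complex.add_re,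
      Complex.add_im, Complex.one_re, Complex.one_im, Complex.I_mul_re, Complex.I_mul_im,
      Complex.ofReal_re, Complex.ofReal_im]
    · simp
    · field_simp
      simp
  refine HasIsotropic.mono (k := (closedHalf d S u).card) ?_ subset_rfl (h u hu)
  have hrot : ∀ τ : ℝ, ∀ j ∈ S, ((τ + Complex.I) * u * d j).re
      = (u * d j).re * (τ - (u * d j).im / (u * d j).re) := by
    intro τ j hj
    have := ha j hj
    rw [mul_assoc, add_mul, Complex.add_re, Complex.re_ofReal_mul, Complex.I_mul_re]
    field_simp
    ring
  have hτ : ∀ τ : ℝ, (τ + Complex.I) * u ≠ 0 := by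
    intro τ
    refine mul_ne_zero (fun h => ?_) hu
    simpa using congrArg Complex.im h
  refine hasIsotropic_of_balanced (c := u⁻¹) (a := fun j => (u * d j).re)
    (t := fun j => (u * d j).im / (u * d j).re) ?_ ha ?_ (by rw [hopen_eq]) ?_ ?_
  · intro j hj
    rw [← hud j hj, inv_mul_cancel_left₀ hu]
  · intro i hi j hj hij
    by_contra hneg
    have hne := mul_ne_zero (ha i hi) (ha j hj)
    have hlt := lt_of_le_of_ne (not_lt.mp hneg) hne
    refine hanti i hi j hj (-((u * d j).re / (u * d i).re)) ?_ ?_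
    · rw [neg_pos]
      rcases mul_neg_iff.mp hlt with h | h
      · exact div_neg_of_neg_of_pos h.2 h.1
      · exact div_neg_of_pos_of_neg h.2 h.1
    · refine mul_left_cancel₀ hu ?_
      have hi0 : ((u * d i).re : ℂ) ≠ 0 := by exact_mod_cast ha i hi
      have hi' := hud i hi
      rw [hij] at hi'
      calc u * d j = _ := hud j hj
        _ = ((u * d j).re / (u * d i).re : ℂ) * ((u * d i).re *
            (1 + Complex.I * (((u * d j).im / (u * d j).re : ℝ) : ℂ))) := by
          rw [← mul_assoc, div_mul_cancel₀ _ hi0]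
        _ = ((u * d j).re / (u * d i).re : ℂ) * (u * d i) := by rw [← hi']
        _ = _ := by
          rw [Complex.ofReal_neg, Complex.ofReal_div]
          ring
  · intro τ
    refine (hopen _ (hτ τ)).trans (Finset.card_le_card fun j hj => ?_)
    rw [Finset.mem_filter] at hj ⊢
    exact ⟨hj.1, by rw [← hrot τ j hj.1]; exact hj.2⟩
  · intro τ
    refine (hopen _ (neg_ne_zero.mpr (hτ τ))).trans (Finset.card_le_card fun j hj => ?_)
    rw [Finset.mem_filter] at hj ⊢
    refine ⟨hj.1, ?_⟩
    rw [← hrot τ j hj.1]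
    have := hj.2
    rw [neg_mul, Complex.neg_re] at this
    linarith

/-- If every closed half-plane with `0` on its boundary contains at least `k` of the points `d j`,
`j ∈ S`, then the form `∑ j, d j * conj (x j) * y j` has an isotropic subspace of dimension `k`. -/
theorem hasIsotropic_of_closedHalf {S : Finset ι} {k : ℕ}
    (h : ∀ u ≠ 0, k ≤ (closedHalf d S u).card) : HasIsotropic d S k := by
  induction hn : S.card using Nat.strong_induction_on generalizing S k with
  | _ n ih =>
    rcases k with _ | k
    · exact HasIsotropic.zero S
    by_cases h0 : ∃ i ∈ S, d i = 0
    · obtain ⟨i, hi, hdi⟩ := h0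
      have := ih _ (hn ▸ Finset.card_erase_lt_of_mem hi)
        (le_card_closedHalf_erase_zero h (i := i)) rfl
      refine (this.union (hasIsotropic_singleton hdi) (by simp)).mono ?_ le_rfl
      exact Finset.union_subset (Finset.erase_subset _ _) (by simpa using hi)
    push Not at h0
    by_cases hanti : ∃ i ∈ S, ∃ j ∈ S, ∃ c : ℝ, 0 < c ∧ d j = -(c * d i)
    · obtain ⟨i, hi, j, hj, c, hc, hij⟩ := hanti
      have hne : j ≠ i := by
        rintro rfl
        have h1 : ((1 + c : ℝ) : ℂ) * d j = 0 := by
          push_cast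
          linear_combination hij
        rcases mul_eq_zero.mp h1 with h2 | h2
        · have : 1 + c = 0 := by exact_mod_cast h2
          linarith
        · exact h0 j hj h2
      have := ih _ (hn ▸ (Finset.card_erase_le.trans_lt (Finset.card_erase_lt_of_mem hi)))
        (le_card_closedHalf_erase_pair h (h0 i hi) hj hc hij) rfl
      refine (this.union (hasIsotropic_pair hne hc.le hij) ?_).mono ?_ le_rfl
      · simp [Finset.disjoint_left]
        tauto
      · refine Finset.union_subset ((Finset.erase_subset _ _).trans (Finset.erase_subset _ _)) ?_
        intro x hx
        rcases Finset.mem_insert.mp hx with rfl | hx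
        · exact hj
        · rwa [Finset.mem_singleton.mp hx]
    push Not at hanti
    exact hasIsotropic_of_no_antipodal h h0 hanti

end Assembly

section Normal

variable {n : ℕ}

/-- The spectral theorem for normal matrices. -/
lemma exists_unitary_diagonal_of_normal (A : Matrix (Fin n) (Fin n) ℂ) (hA : A * Aᴴ = Aᴴ * A) :
    ∃ (U : Matrix (Fin n) (Fin n) ℂ) (a : Fin n → ℂ), Uᴴ * U = 1 ∧ U * Uᴴ = 1 ∧
      A = U * Matrix.diagonal a * Uᴴ := by
  classical
  set H := A + Aᴴ with hH
  set K := Complex.I • (A - Aᴴ) with hK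
  have hHs : (Matrix.toEuclideanLin H).IsSymmetric :=
    Matrix.isSymmetric_toEuclideanLin_iff.mpr (by simp [hH, Matrix.IsHermitian, add_comm])
  have hKs : (Matrix.toEuclideanLin K).IsSymmetric :=
    Matrix.isSymmetric_toEuclideanLin_iff.mpr (by
      rw [Matrix.IsHermitian, hK, Matrix.conjTranspose_smul, Matrix.conjTranspose_sub,
        Matrix.conjTranspose_conjTranspose, Complex.star_def, Complex.conj_I, neg_smul, ← smul_neg,
        neg_sub])
  have hcomm : H * K = K * H := by
    rw [hH, hK, Matrix.mul_smul, Matrix.smul_mul]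
    congr 1
    rw [add_mul, mul_sub, mul_sub, sub_mul, mul_add, mul_add, hA]
    abel
  have hC : Commute (Matrix.toEuclideanLin H) (Matrix.toEuclideanLin K) := by
    refine LinearMap.ext fun x => ?_
    simp only [Module.End.mul_apply, Matrix.toLpLin_apply, Matrix.mulVec_mulVec, hcomm]
  set V : ℂ × ℂ → Submodule ℂ (EuclideanSpace ℂ (Fin n)) := fun i =>
    Module.End.eigenspace (Matrix.toEuclideanLin H) i.2 ⊓
      Module.End.eigenspace (Matrix.toEuclideanLin K) i.1 with hV
  have hinternal : DirectSum.IsInternal V := hHs.directSum_isInternal_of_commute hKs hC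
  have horth : OrthogonalFamily ℂ (fun i => V i) fun i => (V i).subtypeₗᵢ :=
    hHs.orthogonalFamily_eigenspace_inf_eigenspace hKs
  have hfin : {i | V i ≠ ⊥}.Finite :=
    WellFoundedGT.finite_ne_bot_of_iSupIndep hinternal.submodule_iSupIndep
  have : Fintype {i // V i ≠ ⊥} := hfin.fintype
  have hinternal' : DirectSum.IsInternal fun i : {i // V i ≠ ⊥} => V i :=
    DirectSum.isInternal_ne_bot_iff.mpr hinternal
  have horth' := horth.comp (γ := {i // V i ≠ ⊥}) Subtype.val_injective
  have hdim : Module.finrank ℂ (EuclideanSpace ℂ (Fin n)) = n := by simp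
  set b := hinternal'.subordinateOrthonormalBasis hdim horth' with hb
  have hbV : ∀ j, ∃ c : ℂ, A *ᵥ (b j).ofLp = c • (b j).ofLp := by
    intro j
    have hj := hinternal'.subordinateOrthonormalBasis_subordinate hdim j horth'
    rw [← hb] at hj
    obtain ⟨h1, h2⟩ := hj
    rw [SetLike.mem_coe, Module.End.mem_eigenspace_iff, Matrix.toLpLin_apply] at h1 h2
    have h1' := congrArg WithLp.ofLp h1
    have h2' := congrArg WithLp.ofLp h2
    simp only [WithLp.ofLp_smul] at h1' h2'
    have h2A : A = (2⁻¹ : ℂ) • (H - Complex.I • K) := by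
      rw [hH, hK, smul_smul, Complex.I_mul_I, neg_one_smul, sub_neg_eq_add, add_add_sub_cancel,
        ← two_smul ℂ A, smul_smul]
      norm_num
    rw [h2A, Matrix.smul_mulVec, Matrix.sub_mulVec, Matrix.smul_mulVec, h1', h2', smul_smul,
      ← sub_smul, smul_smul]
    exact ⟨_, rfl⟩
  choose a ha using hbV
  set U : Matrix (Fin n) (Fin n) ℂ := Matrix.of fun i j => (b j).ofLp i with hU
  have hUU : Uᴴ * U = 1 := by
    ext i j
    have := orthonormal_iff_ite.mp b.orthonormal i j
    rw [PiLp.inner_apply] at this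
    rw [Matrix.mul_apply, Matrix.one_apply, ← this]
    refine Finset.sum_congr rfl fun l _ => ?_
    simp [hU, Matrix.conjTranspose_apply, mul_comm]
  have hUU' : U * Uᴴ = 1 := mul_eq_one_comm.mp hUU
  refine ⟨U, a, hUU, hUU', ?_⟩
  have hAU : A * U = U * Matrix.diagonal a := by
    ext i j
    have := congrFun (ha j) i
    rw [Matrix.mul_diagonal, Matrix.mul_apply]
    simp only [Matrix.mulVec, dotProduct, Pi.smul_apply, smul_eq_mul] at this
    simpa [hU, mul_comm] using this
  rw [← hAU, mul_assoc, hUU', mul_one]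

lemma le_countP_of_le_sort_getD {M : Multiset ℝ} {k : ℕ} (hk1 : 1 ≤ k) (hk : k ≤ M.card) {x : ℝ}
    (hx : x ≤ (M.sort (· ≤ ·)).getD (M.card - k) 0) : k ≤ M.countP (x ≤ ·) := by
  set L := M.sort (· ≤ ·) with hL
  have hlen : L.length = M.card := Multiset.length_sort ..
  have hidx : M.card - k < L.length := by omega
  rw [List.getD_eq_getElem _ _ hidx] at hx
  have hsorted : L.SortedLE := (Multiset.pairwise_sort M (· ≤ ·)).sortedLE
  have hdrop : (L.drop (M.card - k)).countP (fun y => decide (x ≤ y)) = k := by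
    have hall : ∀ y ∈ L.drop (M.card - k), (fun y => decide (x ≤ y)) y = true := by
      intro y hy
      obtain ⟨i, hi, rfl⟩ := List.mem_iff_getElem.mp hy
      rw [List.getElem_drop, decide_eq_true_eq]
      exact hx.trans (hsorted.getElem_le_getElem_of_le (by omega))
    rw [List.countP_eq_length.mpr hall, List.length_drop]
    omega
  have hle := (List.drop_sublist (M.card - k) L).countP_le (p := fun y => decide (x ≤ y))
  rw [hdrop] at hle
  have hM : (L : Multiset ℝ) = M := Multiset.sort_eq M _
  rw [← hM, Multiset.coe_countP]
  exact hle

lemma le_card_of_le_lambdaKth {k : ℕ} (hk1 : 1 ≤ k) (hkn : k ≤ n) {H U : Matrix (Fin n) (Fin n) ℂ}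
    (hU : Uᴴ * U = 1) {c : Fin n → ℝ} (hH : H = U * Matrix.diagonal (fun j => (c j : ℂ)) * Uᴴ)
    {x : ℝ} (hx : x ≤ lambdaKth H k) : k ≤ (Finset.univ.filter fun j => x ≤ c j).card := by
  have hherm : H.IsHermitian := by
    rw [Matrix.IsHermitian, hH, Matrix.conjTranspose_mul, Matrix.conjTranspose_mul,
      Matrix.conjTranspose_conjTranspose, Matrix.diagonal_conjTranspose, mul_assoc]
    congr 3
    ext j
    simp
  have hroots := hherm.roots_charpoly_eq_eigenvalues
  have hchar : H.charpoly = ∏ j, (Polynomial.X - Polynomial.C (c j : ℂ)) := by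
    rw [hH, Matrix.charpoly_mul_comm, ← mul_assoc, hU, one_mul, Matrix.charpoly_diagonal]
  have hmap : Finset.univ.val.map hherm.eigenvalues = Finset.univ.val.map c := by
    refine Multiset.map_injective Complex.ofReal_injective ?_
    have hprod : (∏ j, (Polynomial.X - Polynomial.C (c j : ℂ))).roots
        = Finset.univ.val.map fun j => (c j : ℂ) := by
      rw [Polynomial.roots_prod]
      · simp
      · simp [Finset.prod_ne_zero_iff, Polynomial.X_sub_C_ne_zero]
    rw [hchar, hprod] at hroots
    rw [Multiset.map_map, Multiset.map_map]
    exact hroots.symm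
  have hcard : Multiset.card (Finset.univ.val.map c) = n := by simp
  rw [lambdaKth, dif_pos hherm, hmap] at hx
  have := le_countP_of_le_sort_getD hk1 (hkn.trans hcard.ge) (x := x) (by rwa [hcard])
  rw [Multiset.countP_map] at this
  exact this

open scoped ComplexOrder in
lemma mem_rankKRange_of_hasIsotropic {k : ℕ} {A U : Matrix (Fin n) (Fin n) ℂ} {a : Fin n → ℂ}
    (hU : Uᴴ * U = 1) (hA : A = U * Matrix.diagonal a * Uᴴ) {μ : ℂ}
    (h : HasIsotropic (fun j => a j - μ) Finset.univ k) : μ ∈ rankKRange k A := by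
  obtain ⟨V, hk, -, hV⟩ := h
  set W := V.map (WithLp.linearEquiv 2 ℂ (Fin n → ℂ)).symm.toLinearMap with hW
  have hdim : Module.finrank ℂ W = Module.finrank ℂ V := LinearEquiv.finrank_map_eq _ _
  have hWV : ∀ x ∈ W, x.ofLp ∈ V := by
    rintro x ⟨y, hy, rfl⟩
    exact hy
  set b := stdOrthonormalBasis ℂ W
  have hkW : k ≤ Module.finrank ℂ W := hdim ▸ hk
  set X : Matrix (Fin n) (Fin k) ℂ :=
    Matrix.of fun i l => (b (Fin.castLE hkW l) : EuclideanSpace ℂ (Fin n)).ofLp i with hX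
  have hXX : Xᴴ * X = 1 := by
    ext i j
    have := orthonormal_iff_ite.mp b.orthonormal (Fin.castLE hkW i) (Fin.castLE hkW j)
    rw [Submodule.coe_inner, PiLp.inner_apply] at this
    rw [Matrix.mul_apply, Matrix.one_apply]
    simp only [Fin.castLE_inj] at this
    rw [← this]
    refine Finset.sum_congr rfl fun l _ => ?_
    simp [hX, Matrix.conjTranspose_apply, mul_comm]
  have hXD : Xᴴ * Matrix.diagonal a * X = μ • (1 : Matrix (Fin k) (Fin k) ℂ) := by
    rw [← hXX, ← sub_eq_zero]
    ext i j
    have := hV _ (hWV _ (b (Fin.castLE hkW i)).2) _ (hWV _ (b (Fin.castLE hkW j)).2)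
    rw [Matrix.sub_apply, Matrix.smul_apply, Matrix.mul_apply, Matrix.mul_apply, Matrix.zero_apply,
      Finset.smul_sum, ← Finset.sum_sub_distrib, ← this]
    refine Finset.sum_congr rfl fun l _ => ?_
    simp only [Matrix.mul_diagonal, Matrix.conjTranspose_apply, hX, Matrix.of_apply, smul_eq_mul]
    ring
  set Q := U * X with hQ
  have hQQ : Qᴴ * Q = 1 := by
    rw [hQ, Matrix.conjTranspose_mul, Matrix.mul_assoc, ← Matrix.mul_assoc Uᴴ, hU, Matrix.one_mul,
      hXX]
  have hQA : Qᴴ * A * Q = μ • (1 : Matrix (Fin k) (Fin k) ℂ) := by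
    rw [← hXD]
    calc Qᴴ * A * Q = Xᴴ * (Uᴴ * U) * Matrix.diagonal a * (Uᴴ * U) * X := by
          rw [hQ, hA, Matrix.conjTranspose_mul]
          simp only [Matrix.mul_assoc]
      _ = _ := by rw [hU, Matrix.mul_one, Matrix.mul_one]
  refine ⟨Q * Qᴴ, Matrix.isHermitian_mul_conjTranspose_self Q, ?_, ?_, ?_⟩
  · rw [Matrix.mul_assoc, ← Matrix.mul_assoc Qᴴ, hQQ, Matrix.one_mul]
  · rw [Matrix.rank_self_mul_conjTranspose, ← Matrix.rank_conjTranspose_mul_self, hQQ,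
      Matrix.rank_one, Fintype.card_fin]
  · calc Q * Qᴴ * A * (Q * Qᴴ) = Q * (Qᴴ * A * Q) * Qᴴ := by simp only [Matrix.mul_assoc]
      _ = _ := by rw [hQA, Matrix.mul_smul, Matrix.mul_one, Matrix.smul_mul]

end Normal

/-- `Ω_k(A) ⊆ Λ_k(A)` for normal `A`. -/
theorem Omega_subset_rankKRange_of_normal {n k : ℕ} (hk1 : 1 ≤ k) (hkn : k ≤ n)
    (A : Matrix (Fin n) (Fin n) ℂ) (hA : A * Aᴴ = Aᴴ * A) (μ : ℂ)
    (hμ : ∀ ξ ∈ Set.Ico (0 : ℝ) (2 * Real.pi),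
      (Complex.exp (ξ * Complex.I) * μ
          + Complex.exp (-(ξ * Complex.I)) * (starRingEnd ℂ) μ).re
        ≤ lambdaKth (Complex.exp (ξ * Complex.I) • A
          + Complex.exp (-(ξ * Complex.I)) • Aᴴ) k) :
    μ ∈ rankKRange k A := by
  obtain ⟨U, a, hU, -, hAU⟩ := exists_unitary_diagonal_of_normal A hA
  refine mem_rankKRange_of_hasIsotropic hU hAU (hasIsotropic_of_closedHalf fun u hu => ?_)
  obtain ⟨ξ, hξ, hexp⟩ : ∃ ξ ∈ Set.Ico (0 : ℝ) (2 * Real.pi),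
      u = ‖u‖ * Complex.exp (ξ * Complex.I) := by
    refine ⟨toIcoMod Real.two_pi_pos 0 u.arg, ?_, ?_⟩
    · simpa using toIcoMod_mem_Ico Real.two_pi_pos 0 u.arg
    · conv_lhs => rw [← Complex.norm_mul_exp_arg_mul_I u]
      congr 1
      rw [Complex.exp_eq_exp_iff_exists_int]
      refine ⟨toIcoDiv Real.two_pi_pos 0 u.arg, ?_⟩
      rw [toIcoMod]
      push_cast
      ring
  set z := Complex.exp (ξ * Complex.I) with hz
  have hzbar : Complex.exp (-(ξ * Complex.I)) = starRingEnd ℂ z := by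
    rw [hz, ← Complex.exp_conj]
    simp
  have h2re : ∀ w : ℂ, z * w + starRingEnd ℂ z * starRingEnd ℂ w = ((2 * (z * w).re : ℝ) : ℂ) := by
    intro w
    rw [← map_mul, Complex.add_conj]
  have hH : z • A + starRingEnd ℂ z • Aᴴ
      = U * Matrix.diagonal (fun j => ((2 * (z * a j).re : ℝ) : ℂ)) * Uᴴ := by
    have hAH : Aᴴ = U * Matrix.diagonal (star a) * Uᴴ := by
      rw [hAU, Matrix.conjTranspose_mul, Matrix.conjTranspose_mul,
        Matrix.conjTranspose_conjTranspose, Matrix.diagonal_conjTranspose, mul_assoc]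
    have hdiag : Matrix.diagonal (fun j => ((2 * (z * a j).re : ℝ) : ℂ))
        = z • Matrix.diagonal a + starRingEnd ℂ z • Matrix.diagonal (star a) := by
      rw [← Matrix.diagonal_smul, ← Matrix.diagonal_smul, Matrix.diagonal_add]
      congr 1
      funext j
      rw [← h2re]
      rfl
    rw [hdiag, hAH, hAU, Matrix.mul_add, Matrix.add_mul, Matrix.mul_smul, Matrix.mul_smul,
      Matrix.smul_mul, Matrix.smul_mul]
  have hξ' := hμ ξ hξ
  rw [← hz, hzbar, h2re, Complex.ofReal_re] at hξ'
  refine (le_card_of_le_lambdaKth hk1 hkn hU hH hξ').trans (Finset.card_le_card fun j hj => ?_)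
  rw [Finset.mem_filter] at hj
  refine Finset.mem_filter.mpr ⟨hj.1, ?_⟩
  rw [hexp, mul_assoc, Complex.re_ofReal_mul, mul_sub, Complex.sub_re]
  exact mul_nonneg (norm_nonneg u) (by linarith [hj.2])
end

section
/- Let A be an n×n complex matrix. Then the minimum over ξ ∈ [0, 2π) of the number of nonnegative eigenvalues (counted with multiplicity) of the Hermitian matrix e^{iξ}A + e^{-iξ}A* equals the maximum dimension of a totally isotropic subspace of A. -/
open Matrix

/-- The number of nonnegative eigenvalues (counted with multiplicity) of a Hermitian
matrix `H`; junk value `0` if `H` is not Hermitian. -/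
noncomputable def numNonnegEig {n : ℕ} (H : Matrix (Fin n) (Fin n) ℂ) : ℕ :=
  if hH : H.IsHermitian then (Finset.univ.filter fun i => 0 ≤ hH.eigenvalues i).card else 0

section
open Module ComplexConjugate Topology

/-- The Hermitian part of `z • A` is negative definite on `W`. -/
def NegDefOn {E : Type*} [NormedAddCommGroup E] [InnerProductSpace ℂ E] (A : E →L[ℂ] E) (z : ℂ)
    (W : Submodule ℂ E) : Prop :=
  ∀ x ∈ W, x ≠ 0 → (z * inner ℂ x (A x)).re < 0

/-- For every `z`, the Hermitian part of `z • A`, restricted to `U`, has at least `k` nonnegative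
eigenvalues (stated through the dimensions of negative definite subspaces). -/
def NonnegIndexGE {E : Type*} [NormedAddCommGroup E] [InnerProductSpace ℂ E] (A : E →L[ℂ] E)
    (U : Submodule ℂ E) (k : ℕ) : Prop :=
  ∀ (z : ℂ) (W : Submodule ℂ E), W ≤ U → NegDefOn A z W → finrank ℂ W + k ≤ finrank ℂ U

/-- `U` contains a nonzero isotropic vector `v` for which the two functionals
`⟪v, A ·⟫` and `⟪A v, ·⟫` are linearly dependent on `U`. -/
def HasPencilIsotropicVector {E : Type*} [NormedAddCommGroup E] [InnerProductSpace ℂ E]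
    (A : E →L[ℂ] E) (U : Submodule ℂ E) : Prop :=
  ∃ v ∈ U, v ≠ 0 ∧ inner ℂ v (A v) = 0 ∧ ∃ α β : ℂ, (α ≠ 0 ∨ β ≠ 0) ∧
    ∀ x ∈ U, α * inner ℂ v (A x) + β * inner ℂ (A v) x = 0

variable {E : Type*} [NormedAddCommGroup E] [InnerProductSpace ℂ E] {A : E →L[ℂ] E}
  {U V W : Submodule ℂ E} {k : ℕ} {z : ℂ}

lemma inner_map_smul_self (A : E →L[ℂ] E) (c : ℂ) (x : E) :
    inner ℂ (c • x) (A (c • x)) = (‖c‖ ^ 2 : ℝ) * inner ℂ x (A x) := by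
  rw [map_smul, inner_smul_left, inner_smul_right, ← mul_assoc, Complex.conj_mul']
  push_cast; rfl

lemma inner_map_add_self (A : E →L[ℂ] E) (x y : E) :
    inner ℂ (x + y) (A (x + y)) =
      inner ℂ x (A x) + inner ℂ x (A y) + inner ℂ y (A x) + inner ℂ y (A y) := by
  simp only [map_add, inner_add_left, inner_add_right]; ring

lemma norm_inner_map_le (A : E →L[ℂ] E) (x y : E) : ‖inner ℂ x (A y)‖ ≤ ‖A‖ * ‖x‖ * ‖y‖ := by
  calc ‖inner ℂ x (A y)‖ ≤ ‖x‖ * ‖A y‖ := norm_inner_le_norm _ _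
    _ ≤ ‖x‖ * (‖A‖ * ‖y‖) := by gcongr; exact A.le_opNorm y
    _ = _ := by ring

lemma inner_map_eq_zero_of_isotropic (h : ∀ x ∈ V, inner ℂ x (A x) = 0) {x y : E} (hx : x ∈ V)
    (hy : y ∈ V) : inner ℂ x (A y) = 0 := by
  have h1 := h _ (V.add_mem hx hy)
  have h2 := h _ (V.add_mem hx (V.smul_mem Complex.I hy))
  rw [inner_map_add_self, h x hx, h y hy] at h1
  rw [inner_map_add_self, h x hx, h _ (V.smul_mem Complex.I hy), map_smul, inner_smul_left,
    inner_smul_right, Complex.conj_I] at h2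
  linear_combination (1 / 2) * h1 - (Complex.I / 2) * h2 +
    (inner ℂ x (A y) - inner ℂ y (A x)) / 2 * Complex.I_mul_I

/-- A negative definite and a nonnegative subspace are disjoint, so their dimensions add up to
at most that of the ambient subspace. -/
lemma finrank_add_le_of_neg_of_nonneg [FiniteDimensional ℂ E] {P : Submodule ℂ E} (hW : W ≤ U)
    (hP : P ≤ U) (hneg : NegDefOn A z W) (hpos : ∀ x ∈ P, 0 ≤ (z * inner ℂ x (A x)).re) :
    finrank ℂ W + finrank ℂ P ≤ finrank ℂ U := by
  have hd : W ⊓ P = ⊥ := by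
    rw [Submodule.eq_bot_iff]
    rintro x ⟨hx, hx'⟩
    by_contra h0
    exact absurd (hneg x hx h0) (not_lt.2 (hpos x hx'))
  have := Submodule.finrank_sup_add_finrank_inf_eq W P
  rw [hd, finrank_bot, add_zero] at this
  rw [← this]
  exact Submodule.finrank_mono (sup_le hW hP)

lemma NegDefOn.nonneg_of_neg {P : Submodule ℂ E} (h : NegDefOn A (-z) P) :
    ∀ x ∈ P, 0 ≤ (z * inner ℂ x (A x)).re := by
  intro x hx
  by_cases h0 : x = 0
  · simp [h0]
  · have := h x hx h0
    rw [neg_mul, Complex.neg_re] at this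
    linarith

/-- A negative definite form on a finite-dimensional space is coercive. -/
lemma NegDefOn.exists_coercive [FiniteDimensional ℂ E] (h : NegDefOn A z W) :
    ∃ a > 0, ∀ x ∈ W, (z * inner ℂ x (A x)).re ≤ -a * ‖x‖ ^ 2 := by
  have hK : IsCompact (Metric.sphere (0 : E) 1 ∩ W) :=
    (isCompact_sphere 0 1).inter_right W.closed_of_finiteDimensional
  have hc : Continuous fun x : E => (z * inner ℂ x (A x)).re := by fun_prop
  obtain hempty | hne := (Metric.sphere (0 : E) 1 ∩ (W : Set E)).eq_empty_or_nonempty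
  · refine ⟨1, one_pos, fun x hx => ?_⟩
    by_cases h0 : x = 0
    · simp [h0]
    · exfalso
      have : ((‖x‖⁻¹ : ℝ) : ℂ) • x ∈ Metric.sphere (0 : E) 1 ∩ (W : Set E) := by
        refine ⟨?_, W.smul_mem _ hx⟩
        simp [norm_smul, h0]
      rw [hempty] at this
      exact this
  · obtain ⟨x0, hx0, hmax⟩ := hK.exists_isMaxOn hne hc.continuousOn
    have hx0' : x0 ≠ 0 := by
      rintro rfl
      simpa using hx0.1
    refine ⟨-(z * inner ℂ x0 (A x0)).re, by linarith [h x0 hx0.2 hx0'], fun x hx => ?_⟩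
    by_cases h0 : x = 0
    · simp [h0]
    have hm := hmax (a := ((‖x‖⁻¹ : ℝ) : ℂ) • x)
      ⟨by simp [norm_smul, h0], W.smul_mem _ hx⟩
    have hn : 0 < ‖x‖ := norm_pos_iff.2 h0
    simp only [Set.mem_ofPred_eq] at hm
    rw [inner_map_smul_self, mul_left_comm, Complex.re_ofReal_mul, Complex.norm_real,
      norm_inv, norm_norm, inv_pow, inv_mul_le_iff₀ (by positivity)] at hm
    linarith

/-- A vector on which a real-valued homogeneous form vanishes, between a positive and a
negative vector. -/
lemma exists_re_eq_zero_of_pos_of_neg {x y : E} (hx : x ∈ W) (hy : y ∈ W)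
    (hxp : 0 < (z * inner ℂ x (A x)).re) (hyn : (z * inner ℂ y (A y)).re < 0) :
    ∃ w ∈ W, w ≠ 0 ∧ (z * inner ℂ w (A w)).re = 0 := by
  have hc : Continuous fun s : ℝ =>
      (z * inner ℂ (((1 - s : ℝ) : ℂ) • x + (s : ℂ) • y)
        (A (((1 - s : ℝ) : ℂ) • x + (s : ℂ) • y))).re := by fun_prop
  obtain ⟨s, hs, hs0⟩ := intermediate_value_Icc' (zero_le_one (α := ℝ)) hc.continuousOn
    (show (0 : ℝ) ∈ Set.Icc _ _ by simpa [-Complex.mul_re] using ⟨hyn.le, hxp.le⟩)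
  refine ⟨_, W.add_mem (W.smul_mem _ hx) (W.smul_mem _ hy), fun h0 => ?_, hs0⟩
  have h1 : ((1 - s : ℝ) : ℂ) • x = (-(s : ℂ)) • y := by
    rw [neg_smul]; exact eq_neg_of_add_eq_zero_left h0
  have h2 := congrArg (fun w => (z * inner ℂ w (A w)).re) h1
  simp only [inner_map_smul_self] at h2
  rw [mul_left_comm, mul_left_comm z, Complex.re_ofReal_mul, Complex.re_ofReal_mul, norm_neg,
    Complex.norm_real, Complex.norm_real, Real.norm_eq_abs, Real.norm_eq_abs, sq_abs, sq_abs] at h2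
  have h3 : 0 ≤ (1 - s) ^ 2 * (z * inner ℂ x (A x)).re := by positivity
  have h4 : s ^ 2 * (z * inner ℂ y (A y)).re ≤ 0 :=
    mul_nonpos_of_nonneg_of_nonpos (sq_nonneg s) hyn.le
  have h5 : (1 - s) ^ 2 * (z * inner ℂ x (A x)).re = 0 := by linarith
  have h6 : s ^ 2 * (z * inner ℂ y (A y)).re = 0 := by linarith
  have h7 : 1 - s = 0 := by simpa [-Complex.mul_re, hxp.ne'] using h5
  have h8 : s = 0 := by simpa [-Complex.mul_re, hyn.ne] using h6
  linarith

section Eigenbasis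

variable {F ι : Type*} [NormedAddCommGroup F] [InnerProductSpace ℂ F] [Fintype ι]
  (b : OrthonormalBasis ι ℂ F)

lemma OrthonormalBasis.finrank_span_image (p : ι → Prop) [DecidablePred p] :
    finrank ℂ (Submodule.span ℂ (b '' {i | p i})) = (Finset.univ.filter p).card := by
  have hli : LinearIndependent ℂ fun i : {i // p i} => b i :=
    b.orthonormal.linearIndependent.comp _ Subtype.val_injective
  have h := finrank_span_eq_card hli
  rw [Fintype.card_subtype] at h
  rw [← h, Set.image_eq_range]
  rfl

lemma OrthonormalBasis.inner_eq_zero_of_mem_span_image {p : ι → Prop} {x : F}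
    (hx : x ∈ Submodule.span ℂ (b '' {i | p i})) {i : ι} (hi : ¬ p i) : inner ℂ (b i) x = 0 := by
  induction hx using Submodule.span_induction with
  | mem x h =>
    obtain ⟨j, hj, rfl⟩ := h
    have hij : i ≠ j := by rintro rfl; exact hi hj
    exact b.orthonormal.2 hij
  | zero => simp
  | add x y _ _ hx hy => rw [inner_add_right, hx, hy, add_zero]
  | smul c x _ hx => rw [inner_smul_right, hx, mul_zero]

lemma OrthonormalBasis.map_eq_sum {T : F →ₗ[ℂ] F} {l : ι → ℝ}
    (hT : ∀ i, T (b i) = (l i : ℂ) • b i) (x : F) :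
    T x = ∑ i, ((l i : ℂ) * inner ℂ (b i) x) • b i := by
  conv_lhs => rw [← b.sum_repr' x]
  simp only [map_sum, map_smul, hT, smul_smul]
  exact Finset.sum_congr rfl fun i _ => by rw [mul_comm]

lemma OrthonormalBasis.inner_map_self_eq_sum {T : F →ₗ[ℂ] F} {l : ι → ℝ}
    (hT : ∀ i, T (b i) = (l i : ℂ) • b i) (x : F) :
    (inner ℂ x (T x)).re = ∑ i, l i * ‖inner ℂ (b i) x‖ ^ 2 := by
  rw [b.map_eq_sum hT, inner_sum, Complex.re_sum]
  refine Finset.sum_congr rfl fun i _ => ?_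
  rw [inner_smul_right, mul_assoc, ← inner_conj_symm x (b i), Complex.mul_conj,
    Complex.normSq_eq_norm_sq, Complex.re_ofReal_mul, Complex.ofReal_re]

lemma OrthonormalBasis.inner_map_self_neg_of_mem_span {T : F →ₗ[ℂ] F} {l : ι → ℝ}
    (hT : ∀ i, T (b i) = (l i : ℂ) • b i) {x : F}
    (hx : x ∈ Submodule.span ℂ (b '' {i | l i < 0})) (h0 : x ≠ 0) :
    (inner ℂ x (T x)).re < 0 := by
  have hle : ∀ i ∈ Finset.univ, l i * ‖inner ℂ (b i) x‖ ^ 2 ≤ 0 := by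
    intro i _
    by_cases hi : l i < 0
    · exact mul_nonpos_of_nonpos_of_nonneg hi.le (by positivity)
    · simp [b.inner_eq_zero_of_mem_span_image hx hi]
  rw [b.inner_map_self_eq_sum hT]
  refine lt_of_le_of_ne (Finset.sum_nonpos hle) fun h => h0 ?_
  rw [Finset.sum_eq_zero_iff_of_nonpos hle] at h
  rw [← b.sum_repr' x]
  refine Finset.sum_eq_zero fun i hi => ?_
  by_cases hl : l i < 0
  · have : inner ℂ (b i) x = 0 := by simpa [hl.ne] using h i hi
    rw [this, zero_smul]
  · rw [b.inner_eq_zero_of_mem_span_image hx hl, zero_smul]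

lemma OrthonormalBasis.inner_map_self_nonneg_of_mem_span {T : F →ₗ[ℂ] F} {l : ι → ℝ}
    (hT : ∀ i, T (b i) = (l i : ℂ) • b i) {x : F}
    (hx : x ∈ Submodule.span ℂ (b '' {i | 0 ≤ l i})) :
    0 ≤ (inner ℂ x (T x)).re := by
  rw [b.inner_map_self_eq_sum hT]
  refine Finset.sum_nonneg fun i _ => ?_
  by_cases hi : 0 ≤ l i
  · positivity
  · simp [b.inner_eq_zero_of_mem_span_image hx hi]

lemma OrthonormalBasis.map_eq_zero_of_mem_span_nonneg {T : F →ₗ[ℂ] F} {l : ι → ℝ}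
    (hT : ∀ i, T (b i) = (l i : ℂ) • b i) {x : F}
    (hx : x ∈ Submodule.span ℂ (b '' {i | 0 ≤ l i})) (h : (inner ℂ x (T x)).re = 0) :
    T x = 0 := by
  have hle : ∀ i ∈ Finset.univ, 0 ≤ l i * ‖inner ℂ (b i) x‖ ^ 2 := by
    intro i _
    by_cases hi : 0 ≤ l i
    · positivity
    · simp [b.inner_eq_zero_of_mem_span_image hx hi]
  rw [b.inner_map_self_eq_sum hT, Finset.sum_eq_zero_iff_of_nonneg hle] at h
  rw [b.map_eq_sum hT]
  refine Finset.sum_eq_zero fun i hi => ?_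
  have : l i = 0 ∨ inner ℂ (b i) x = 0 := by simpa using h i hi
  rcases this with h | h <;> simp [h]

end Eigenbasis

lemma inner_sub_smul_one_self (A : E →L[ℂ] E) (t : ℝ) (x : E) :
    inner ℂ x ((A - (t : ℂ) • (1 : E →L[ℂ] E)) x) = inner ℂ x (A x) - (t * ‖x‖ ^ 2 : ℝ) := by
  simp [inner_self_eq_norm_sq_to_K]

lemma NegDefOn.of_sphere (h : ∀ x ∈ W, ‖x‖ = 1 → (z * inner ℂ x (A x)).re < 0) :
    NegDefOn A z W := by
  intro x hx h0
  have hm := h (((‖x‖⁻¹ : ℝ) : ℂ) • x) (W.smul_mem _ hx) (by simp [norm_smul, h0])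
  have hn : 0 < ‖x‖ := norm_pos_iff.2 h0
  rw [inner_map_smul_self, mul_left_comm, Complex.re_ofReal_mul] at hm
  by_contra! hcon
  exact absurd hm (not_lt.2 (mul_nonneg (by positivity) hcon))

lemma sub_smul_one_sub_smul_one (A : E →L[ℂ] E) (s t : ℝ) :
    A - (s : ℂ) • (1 : E →L[ℂ] E) - (t : ℂ) • (1 : E →L[ℂ] E) =
      A - ((s + t : ℝ) : ℂ) • (1 : E →L[ℂ] E) := by
  push_cast
  rw [add_smul, sub_sub]

lemma NonnegIndexGE.neg (hC : NonnegIndexGE A U k) : NonnegIndexGE (-A) U k := by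
  intro z W hW hneg
  refine hC (-z) W hW fun x hx h0 => ?_
  simpa [-Complex.mul_re] using hneg x hx h0

variable [FiniteDimensional ℂ E]

/-- Splitting of `U` into a negative definite and a positive semidefinite part of the Hermitian
part of `z • A`. -/
lemma exists_negDefOn_and_nonneg (A : E →L[ℂ] E) (U : Submodule ℂ E) (z : ℂ) :
    ∃ P M : Submodule ℂ E, P ≤ U ∧ M ≤ U ∧ finrank ℂ P + finrank ℂ M = finrank ℂ U ∧
      NegDefOn A z P ∧ (∀ x ∈ M, 0 ≤ (z * inner ℂ x (A x)).re) ∧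
      ∀ x ∈ M, (z * inner ℂ x (A x)).re = 0 →
        ∀ y ∈ U, z * inner ℂ y (A x) + conj z * inner ℂ (A y) x = 0 := by
  let B : U →L[ℂ] U := z • (U.orthogonalProjectionOnto ∘L A ∘L U.subtypeL)
  have hB : ∀ x y : U, inner ℂ x (B y) = z * inner ℂ (x : E) (A y) := by
    intro x y
    simp [B]
  have hB' : ∀ x y : U, inner ℂ (B x) y = conj z * inner ℂ (A x) (y : E) := by
    intro x y
    rw [← inner_conj_symm, hB, map_mul, inner_conj_symm]
  let T : U →ₗ[ℂ] U := (B + ContinuousLinearMap.adjoint B : U →L[ℂ] U)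
  have hTi : ∀ x y : U, inner ℂ x (T y) =
      z * inner ℂ (x : E) (A y) + conj z * inner ℂ (A x) (y : E) := by
    intro x y
    simp [T, ContinuousLinearMap.adjoint_inner_right, hB, hB']
  have hT : T.IsSymmetric := by
    intro x y
    rw [← inner_conj_symm, hTi, hTi]
    simp only [map_add, map_mul, inner_conj_symm, Complex.conj_conj]
    ring
  have hre : ∀ x : U, (inner ℂ x (T x)).re = 2 * (z * inner ℂ (x : E) (A x)).re := by
    intro x
    rw [hTi, ← inner_conj_symm (A (x : E)) (x : E), ← map_mul, Complex.add_re, Complex.conj_re]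
    ring
  let b := hT.eigenvectorBasis rfl
  have hb : ∀ i, T (b i) = (hT.eigenvalues rfl i : ℂ) • b i :=
    fun i => hT.apply_eigenvectorBasis rfl i
  refine ⟨(Submodule.span ℂ (b '' {i | hT.eigenvalues rfl i < 0})).map U.subtype,
    (Submodule.span ℂ (b '' {i | 0 ≤ hT.eigenvalues rfl i})).map U.subtype,
    Submodule.map_subtype_le _ _, Submodule.map_subtype_le _ _, ?_, ?_, ?_, ?_⟩
  · rw [Submodule.finrank_map_subtype_eq, Submodule.finrank_map_subtype_eq,
      b.finrank_span_image, b.finrank_span_image]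
    have := Finset.card_filter_add_card_filter_not (s := Finset.univ)
      (fun i => hT.eigenvalues rfl i < 0)
    simpa using this
  · rintro _ ⟨x, hx, rfl⟩ h0
    have := b.inner_map_self_neg_of_mem_span hb hx (by rintro rfl; simp at h0)
    rw [hre] at this
    simpa [-Complex.mul_re] using by linarith
  · rintro _ ⟨x, hx, rfl⟩
    have := b.inner_map_self_nonneg_of_mem_span hb hx
    rw [hre] at this
    simpa [-Complex.mul_re] using by linarith
  · rintro _ ⟨x, hx, rfl⟩ h y hy
    have := b.map_eq_zero_of_mem_span_nonneg hb hx (by rw [hre]; simpa [-Complex.mul_re] using h)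
    have h2 := hTi ⟨y, hy⟩ x
    rw [this, inner_zero_right] at h2
    exact h2.symm

/-- Negative definiteness is stable under small perturbations. -/
lemma NegDefOn.eventually (h : NegDefOn A z W) :
    ∀ᶠ p : ℝ × ℂ in 𝓝 (0, z), NegDefOn (A - (p.1 : ℂ) • (1 : E →L[ℂ] E)) p.2 W := by
  obtain ⟨a, ha, hW⟩ := h.exists_coercive
  have hc : Continuous fun p : ℝ × ℂ => ‖p.2 - z‖ * ‖A‖ + ‖p.2‖ * |p.1| := by fun_prop
  have hlt := hc.continuousAt.eventually_lt (x₀ := ((0 : ℝ), z)) continuousAt_const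
    (show _ < a by simpa using ha)
  filter_upwards [hlt] with p hp x hx h0
  have hn : 0 < ‖x‖ ^ 2 := by positivity
  rw [inner_sub_smul_one_self]
  have h1 : (p.2 * (inner ℂ x (A x) - (p.1 * ‖x‖ ^ 2 : ℝ))).re =
      (z * inner ℂ x (A x)).re + ((p.2 - z) * inner ℂ x (A x)).re -
        (p.2 * (p.1 * ‖x‖ ^ 2 : ℝ)).re := by
    rw [← Complex.add_re, ← Complex.sub_re]; ring_nf
  have h2 : ((p.2 - z) * inner ℂ x (A x)).re ≤ ‖p.2 - z‖ * ‖A‖ * ‖x‖ ^ 2 := by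
    refine (Complex.re_le_norm _).trans ?_
    rw [norm_mul, mul_assoc]
    gcongr
    exact (norm_inner_map_le A x x).trans_eq (by ring)
  have h3 : -(p.2 * (p.1 * ‖x‖ ^ 2 : ℝ)).re ≤ ‖p.2‖ * |p.1| * ‖x‖ ^ 2 := by
    refine (neg_le_abs _).trans ((Complex.abs_re_le_norm _).trans_eq ?_)
    rw [norm_mul, Complex.norm_real, norm_mul, norm_pow, norm_norm, Real.norm_eq_abs]
    ring
  rw [h1]
  nlinarith [hW x hx, mul_lt_mul_of_pos_right hp hn]

/-- If a nonpositive form can be made strictly negative on its null vectors by another form,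
then some combination is negative definite. -/
lemma exists_negDefOn_of_nonpos {w : ℂ} (hz : ∀ x ∈ W, (z * inner ℂ x (A x)).re ≤ 0)
    (hw : ∀ x ∈ W, x ≠ 0 → (z * inner ℂ x (A x)).re = 0 → (w * inner ℂ x (A x)).re < 0) :
    ∃ z', NegDefOn A z' W := by
  have hK : IsCompact (Metric.sphere (0 : E) 1 ∩ W) :=
    (isCompact_sphere 0 1).inter_right W.closed_of_finiteDimensional
  have hev : ∀ᶠ δ : ℝ in 𝓝 0, ∀ x ∈ Metric.sphere (0 : E) 1 ∩ (W : Set E),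
      x ∈ W → 0 < δ → ((z + δ * w) * inner ℂ x (A x)).re < 0 := by
    refine hK.eventually_forall_of_forall_eventually fun x hx => ?_
    have hx0 : x ≠ 0 := by
      rintro rfl
      simpa using hx.1
    rcases (hz x hx.2).lt_or_eq with hlt | heq
    · have hc : Continuous fun p : ℝ × E => ((z + p.1 * w) * inner ℂ p.2 (A p.2)).re := by
        fun_prop
      filter_upwards [hc.continuousAt.eventually_lt (x₀ := ((0 : ℝ), x)) continuousAt_const
        (show _ < (0 : ℝ) by simpa [-Complex.mul_re] using hlt)] with p hp _ _ using hp
    · have hc : Continuous fun p : ℝ × E => (w * inner ℂ p.2 (A p.2)).re := by fun_prop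
      filter_upwards [hc.continuousAt.eventually_lt (x₀ := ((0 : ℝ), x)) continuousAt_const
        (show _ < (0 : ℝ) from hw x hx.2 hx0 heq)] with p hp hpW hp0
      rw [add_mul, Complex.add_re, mul_assoc, Complex.re_ofReal_mul]
      nlinarith [hz p.2 hpW, mul_neg_of_pos_of_neg hp0 hp]
  obtain ⟨δ, hδ, hδ0⟩ := ((hev.filter_mono nhdsWithin_le_nhds).and
    (self_mem_nhdsWithin (a := (0 : ℝ)) (s := Set.Ioi 0))).exists
  exact ⟨z + δ * w, NegDefOn.of_sphere fun x hx hn => hδ x ⟨by simpa using hn, hx⟩ hx hδ0⟩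

/-- Without isotropic vectors in the pencil, the index bound holds strictly. -/
lemma NonnegIndexGE.exists_negDefOn (hC : NonnegIndexGE A U k)
    (hG : ¬ HasPencilIsotropicVector A U) (hz : z ≠ 0) :
    ∃ P ≤ U, k ≤ finrank ℂ P ∧ NegDefOn A z P := by
  obtain ⟨P, M, hP, hM, hdim, hneg, hnn, hker⟩ := exists_negDefOn_and_nonneg A U z
  refine ⟨P, hP, ?_, hneg⟩
  suffices ∃ z', NegDefOn A z' M by
    obtain ⟨z', h⟩ := this
    have := hC z' M hM h
    omega
  let N : Submodule ℂ E :=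
    { carrier := {x | x ∈ M ∧ ∀ y ∈ U, z * inner ℂ y (A x) + conj z * inner ℂ (A y) x = 0}
      add_mem' := by
        rintro x x' ⟨hx, h⟩ ⟨hx', h'⟩
        refine ⟨M.add_mem hx hx', fun y hy => ?_⟩
        rw [map_add, inner_add_right, inner_add_right]
        linear_combination h y hy + h' y hy
      zero_mem' := ⟨M.zero_mem, by simp⟩
      smul_mem' := by
        rintro c x ⟨hx, h⟩
        refine ⟨M.smul_mem c hx, fun y hy => ?_⟩
        rw [map_smul, inner_smul_right, inner_smul_right]
        linear_combination c * h y hy }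
  have hN : ∀ x ∈ N, (z * inner ℂ x (A x)).re = 0 := by
    intro x hx
    have h := congrArg Complex.re (hx.2 x (hM hx.1))
    rw [← inner_conj_symm (A x) x, ← map_mul, Complex.add_re, Complex.conj_re,
      Complex.zero_re] at h
    linarith
  have hne : ∀ x ∈ N, x ≠ 0 → (Complex.I * z * inner ℂ x (A x)).re ≠ 0 := by
    intro x hx h0 h
    have hre := hN x hx
    have hq : z * inner ℂ x (A x) = 0 := by
      refine Complex.ext hre ?_
      rw [mul_assoc, Complex.I_mul_re] at h
      simpa [-Complex.mul_im] using h
    refine hG ⟨x, hM hx.1, h0, by simpa [hz] using hq, z, conj z, Or.inl hz, fun y hy => ?_⟩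
    have := congrArg conj (hx.2 y hy)
    simp only [map_add, map_mul, inner_conj_symm, Complex.conj_conj, map_zero] at this
    linear_combination this
  by_cases hs : ∀ x ∈ N, x ≠ 0 → (Complex.I * z * inner ℂ x (A x)).re < 0
  · refine exists_negDefOn_of_nonpos (z := -z) (w := Complex.I * z) (fun x hx => ?_)
      fun x hx h0 h => hs x ⟨hx, hker x hx ?_⟩ h0
    · rw [neg_mul, Complex.neg_re]
      linarith [hnn x hx]
    · rw [neg_mul, Complex.neg_re] at h
      linarith
  · push Not at hs
    obtain ⟨x, hx, hx0, hxp⟩ := hs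
    refine exists_negDefOn_of_nonpos (z := -z) (w := -(Complex.I * z)) (fun y hy => ?_)
      fun y hy h0 h => ?_
    · rw [neg_mul, Complex.neg_re]
      linarith [hnn y hy]
    · rw [neg_mul, Complex.neg_re] at h
      have hyN : y ∈ N := ⟨hy, hker y hy (by linarith)⟩
      by_contra hcon
      rw [neg_mul, Complex.neg_re] at hcon
      obtain ⟨w, hw, hw0, hwz⟩ := exists_re_eq_zero_of_pos_of_neg hx hyN
        (lt_of_le_of_ne hxp (hne x hx hx0).symm)
        (lt_of_le_of_ne (by linarith) (hne y hyN h0))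
      exact hne w hw hw0 hwz

lemma NonnegIndexGE.eventually (hC : NonnegIndexGE A U k)
    (hG : ¬ HasPencilIsotropicVector A U) :
    ∀ᶠ t : ℝ in 𝓝 0, NonnegIndexGE (A - (t : ℂ) • (1 : E →L[ℂ] E)) U k := by
  have hev : ∀ᶠ t : ℝ in 𝓝 0, ∀ z ∈ Metric.sphere (0 : ℂ) 1,
      ∃ P ≤ U, k ≤ finrank ℂ P ∧ NegDefOn (A - (t : ℂ) • (1 : E →L[ℂ] E)) z P := by
    refine (isCompact_sphere (0 : ℂ) 1).eventually_forall_of_forall_eventually fun z hz => ?_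
    obtain ⟨P, hP, hk, hneg⟩ := hC.exists_negDefOn hG (z := z) (by rintro rfl; simp at hz)
    filter_upwards [hneg.eventually] with p hp using ⟨P, hP, hk, hp⟩
  filter_upwards [hev] with t ht z W hW hneg
  by_cases hz : z = 0
  · have hW0 : W = ⊥ := by
      rw [Submodule.eq_bot_iff]
      intro x hx
      by_contra h0
      simpa [hz] using hneg x hx h0
    have := hC 0 ⊥ bot_le fun x hx h0 => absurd hx h0
    rwa [hW0]
  · obtain ⟨P, hP, hk, hpos⟩ := ht (-(((‖z‖⁻¹ : ℝ) : ℂ) * z)) (by simp [hz])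
    have hneg' : NegDefOn (A - (t : ℂ) • (1 : E →L[ℂ] E)) (((‖z‖⁻¹ : ℝ) : ℂ) * z) W := by
      intro x hx h0
      rw [mul_assoc, Complex.re_ofReal_mul]
      exact mul_neg_of_pos_of_neg (by positivity) (hneg x hx h0)
    have := finrank_add_le_of_neg_of_nonneg hW hP hneg' hpos.nonneg_of_neg
    omega

/-- Translating `A` along the real axis, the index bound persists until an isotropic vector
appears in the pencil. -/
lemma NonnegIndexGE.exists_translate (hC : NonnegIndexGE A U k) (hk : 0 < k) :
    ∃ t : ℝ, 0 ≤ t ∧ NonnegIndexGE (A - (t : ℂ) • (1 : E →L[ℂ] E)) U k ∧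
      HasPencilIsotropicVector (A - (t : ℂ) • (1 : E →L[ℂ] E)) U := by
  let S : Set ℝ := {t | 0 ≤ t ∧ NonnegIndexGE (A - (t : ℂ) • (1 : E →L[ℂ] E)) U k}
  have h0S : (0 : ℝ) ∈ S := ⟨le_rfl, by simpa using hC⟩
  have hbdd : BddAbove S := by
    refine ⟨‖A‖, fun t ht => ?_⟩
    by_contra! hlt
    have := ht.2 1 U le_rfl fun x hx h0 => by
      have hn : 0 < ‖x‖ ^ 2 := by positivity
      rw [inner_sub_smul_one_self, one_mul, Complex.sub_re, Complex.ofReal_re]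
      nlinarith [(Complex.re_le_norm _).trans (norm_inner_map_le A x x)]
    omega
  have hmem : sSup S ∈ S := by
    refine ⟨le_csSup hbdd h0S, ?_⟩
    intro z W hW hneg
    have hev : ∀ᶠ t : ℝ in 𝓝 0, NegDefOn (A - ((sSup S : ℝ) : ℂ) • (1 : E →L[ℂ] E) -
        (t : ℂ) • (1 : E →L[ℂ] E)) z W :=
      (Continuous.tendsto' (f := fun t : ℝ => (t, z)) (by fun_prop) 0 _ rfl).eventually
        hneg.eventually
    obtain ⟨ε, hε, hball⟩ := Metric.eventually_nhds_iff.1 hev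
    obtain ⟨s, hs, hlt⟩ := exists_lt_of_lt_csSup ⟨0, h0S⟩ (sub_lt_self (sSup S) hε)
    have hle := le_csSup hbdd hs
    have := hball (y := s - sSup S) (by rw [Real.dist_eq, sub_zero, abs_lt]; constructor <;> linarith)
    simp only [sub_smul_one_sub_smul_one, add_sub_cancel] at this
    exact hs.2 z W hW this
  refine ⟨sSup S, hmem.1, hmem.2, ?_⟩
  by_contra hG
  obtain ⟨ε, hε, hball⟩ := Metric.eventually_nhds_iff.1 (hmem.2.eventually hG)
  have h := hball (y := ε / 2) (by rw [Real.dist_eq, sub_zero, abs_of_pos] <;> linarith)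
  rw [sub_smul_one_sub_smul_one] at h
  have := le_csSup hbdd (show sSup S + ε / 2 ∈ S from ⟨by linarith [hmem.1], h⟩)
  linarith

lemma finrank_le_finrank_inf_ker_add_one (U : Submodule ℂ E) (φ : E →ₗ[ℂ] ℂ) :
    finrank ℂ U ≤ finrank ℂ (U ⊓ LinearMap.ker φ : Submodule ℂ E) + 1 := by
  by_cases h : U ≤ LinearMap.ker φ
  · rw [inf_eq_left.2 h]
    exact Nat.le_succ _
  · obtain ⟨u, hu, hφ⟩ := SetLike.not_le_iff_exists.1 h
    have hu' : u ∉ U ⊓ LinearMap.ker φ := fun h => hφ h.2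
    rw [← Submodule.finrank_sup_span_singleton hu']
    refine Submodule.finrank_mono fun x hx => ?_
    have hne : φ u ≠ 0 := hφ
    rw [← sub_add_cancel x ((φ x / φ u) • u)]
    refine Submodule.add_mem_sup ⟨U.sub_mem hx (U.smul_mem _ hu), ?_⟩
      (Submodule.smul_mem _ _ (Submodule.mem_span_singleton_self u))
    simp [hne]

/-- A negative definite subspace can be enlarged using an isotropic vector that is orthogonal
to it, but not orthogonal to everything. -/
lemma NegDefOn.exists_sup_span_singleton (hW : NegDefOn A z W) {u v : E}
    (hv : inner ℂ v (A v) = 0) (hvW : ∀ x ∈ W, inner ℂ v (A x) = 0 ∧ inner ℂ (A v) x = 0)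
    (huv : z * inner ℂ u (A v) + conj z * inner ℂ (A u) v ≠ 0) :
    ∃ s : ℂ, NegDefOn A z (W ⊔ Submodule.span ℂ {u + s • v}) := by
  obtain ⟨a, ha, hWa⟩ := hW.exists_coercive
  set c := z * inner ℂ u (A v) + conj z * inner ℂ (A u) v with hc
  set L := 2 * (‖z‖ * ‖A‖ * ‖u‖) with hL
  set τ : ℝ := (z * inner ℂ u (A u)).re + L ^ 2 / a + 1 with hτ
  set s : ℂ := -τ / c with hs
  refine ⟨s, fun x hx h0 => ?_⟩
  obtain ⟨w, hw, y, hy, rfl⟩ := Submodule.mem_sup.1 hx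
  obtain ⟨d, rfl⟩ := Submodule.mem_span_singleton.1 hy
  have hy1 : (z * inner ℂ (u + s • v) (A (u + s • v))).re = -(L ^ 2 / a) - 1 := by
    have h1 : (conj s * (z * inner ℂ v (A u))).re = (s * (conj z * inner ℂ (A u) v)).re := by
      rw [← Complex.conj_re]
      simp only [map_mul, inner_conj_symm, Complex.conj_conj]
    have h2 : s * c = ((-τ : ℝ) : ℂ) := by
      rw [hs]; push_cast; field_simp
    have h3 : z * inner ℂ (u + s • v) (A (u + s • v)) = z * inner ℂ u (A u) +
        s * (z * inner ℂ u (A v)) + conj s * (z * inner ℂ v (A u)) := by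
      rw [inner_map_add_self, inner_map_smul_self, hv, map_smul, inner_smul_left,
        inner_smul_right]
      ring
    have h4 := congrArg Complex.re h2
    rw [hc, mul_add, Complex.add_re, Complex.ofReal_re] at h4
    rw [h3, Complex.add_re, Complex.add_re, h1]
    linarith
  have hq : z * inner ℂ (w + d • (u + s • v)) (A (w + d • (u + s • v))) =
      z * inner ℂ w (A w) + (z * (d * inner ℂ w (A u)) + z * (conj d * inner ℂ u (A w))) +
        (‖d‖ ^ 2 : ℝ) * (z * inner ℂ (u + s • v) (A (u + s • v))) := by
    have hwv : inner ℂ w (A v) = 0 := by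
      rw [← inner_conj_symm, (hvW w hw).2, map_zero]
    rw [inner_map_add_self, inner_map_smul_self, map_smul, inner_smul_right, inner_smul_left,
      map_add, map_smul, inner_add_left, inner_add_right, inner_smul_left, inner_smul_right,
      (hvW w hw).1, hwv]
    ring
  have hcross : (z * (d * inner ℂ w (A u)) + z * (conj d * inner ℂ u (A w))).re ≤
      L * ‖d‖ * ‖w‖ := by
    refine (Complex.re_le_norm _).trans ((norm_add_le _ _).trans ?_)
    rw [norm_mul, norm_mul, norm_mul, norm_mul, RCLike.norm_conj]
    have h1 := norm_inner_map_le A w u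
    have h2 := norm_inner_map_le A u w
    calc ‖z‖ * (‖d‖ * ‖inner ℂ w (A u)‖) + ‖z‖ * (‖d‖ * ‖inner ℂ u (A w)‖)
        ≤ ‖z‖ * (‖d‖ * (‖A‖ * ‖w‖ * ‖u‖)) + ‖z‖ * (‖d‖ * (‖A‖ * ‖u‖ * ‖w‖)) := by gcongr
      _ = L * ‖d‖ * ‖w‖ := by rw [hL]; ring
  rw [hq, Complex.add_re, Complex.add_re, Complex.re_ofReal_mul, hy1]
  have hmain := hWa w hw
  have hsq : L * ‖d‖ * ‖w‖ ≤ a / 2 * ‖w‖ ^ 2 + L ^ 2 / a * ‖d‖ ^ 2 := by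
    have h1 : 0 ≤ (a * ‖w‖ - L * ‖d‖) ^ 2 / (2 * a) := by positivity
    have h2 : (a * ‖w‖ - L * ‖d‖) ^ 2 / (2 * a) =
        a / 2 * ‖w‖ ^ 2 + L ^ 2 / a * ‖d‖ ^ 2 / 2 - L * ‖d‖ * ‖w‖ := by
      field_simp
      ring
    have h3 : 0 ≤ L ^ 2 / a * ‖d‖ ^ 2 := by positivity
    linarith
  by_cases hd : d = 0
  · have hw0 : 0 < ‖w‖ := by
      rw [norm_pos_iff]
      rintro rfl
      simp [hd] at h0
    have : 0 < a * ‖w‖ ^ 2 := by positivity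
    simp only [hd, norm_zero] at hsq hcross ⊢
    nlinarith
  · have h1 : 0 < ‖d‖ ^ 2 := by positivity
    have h2 : 0 ≤ a * ‖w‖ ^ 2 := by positivity
    nlinarith

/-- An isotropic vector in the pencil reduces the problem to a smaller space. -/
lemma NonnegIndexGE.exists_reduction (hC : NonnegIndexGE A U (k + 1))
    (hG : HasPencilIsotropicVector A U) :
    ∃ v ∈ U, inner ℂ v (A v) = 0 ∧ ∃ U' ≤ U, v ∉ U' ∧
      (∀ x ∈ U', inner ℂ v (A x) = 0 ∧ inner ℂ (A v) x = 0) ∧ NonnegIndexGE A U' k := by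
  obtain ⟨v, hvU, hv0, hv, α, β, hαβ, hdep⟩ := hG
  have hv' : inner ℂ (A v) v = 0 := by rw [← inner_conj_symm, hv, map_zero]
  let φ : E →ₗ[ℂ] ℂ := (innerSL ℂ v ∘L A : E →L[ℂ] ℂ)
  let ψ : E →ₗ[ℂ] ℂ := (innerSL ℂ (A v) : E →L[ℂ] ℂ)
  have hφ : ∀ x, φ x = inner ℂ v (A x) := fun x => rfl
  have hψ : ∀ x, ψ x = inner ℂ (A v) x := fun x => rfl
  let U₁ := U ⊓ LinearMap.ker φ ⊓ LinearMap.ker ψ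
  have hU₁ : finrank ℂ U ≤ finrank ℂ U₁ + 1 := by
    rcases hαβ with hα | hβ
    · refine (finrank_le_finrank_inf_ker_add_one U ψ).trans ?_
      gcongr
      refine Submodule.finrank_mono fun x hx => ⟨⟨hx.1, ?_⟩, hx.2⟩
      have h1 := hdep x hx.1
      have h2 : inner ℂ (A v) x = 0 := hx.2
      exact (hφ x).trans (by simpa [h2, hα] using h1)
    · refine (finrank_le_finrank_inf_ker_add_one U φ).trans ?_
      gcongr
      refine Submodule.finrank_mono fun x hx => ⟨⟨hx.1, hx.2⟩, ?_⟩
      have h1 := hdep x hx.1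
      have h2 : inner ℂ v (A x) = 0 := hx.2
      exact (hψ x).trans (by simpa [h2, hβ] using h1)
  have hvU₁ : v ∈ U₁ := ⟨⟨hvU, hv⟩, hv'⟩
  let U₂ := U₁ ⊓ LinearMap.ker (innerSL ℂ v : E →L[ℂ] ℂ).toLinearMap
  have hvU₂ : v ∉ U₂ := fun h => hv0 (inner_self_eq_zero.1 h.2)
  have hU₂ : finrank ℂ U₁ ≤ finrank ℂ U₂ + 1 := finrank_le_finrank_inf_ker_add_one _ _
  have hU₂₁ : U₂ ≤ U₁ := inf_le_left
  have hU₁U : U₁ ≤ U := inf_le_left.trans inf_le_left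
  have horth : ∀ x ∈ U₂, inner ℂ v (A x) = 0 ∧ inner ℂ (A v) x = 0 :=
    fun x hx => ⟨hx.1.1.2, hx.1.2⟩
  refine ⟨v, hvU, hv, U₂, hU₂₁.trans hU₁U, hvU₂, horth, ?_⟩
  intro z W hW hneg
  by_cases hle : U ≤ U₁
  · have := hC z W (hW.trans (hU₂₁.trans hU₁U)) hneg
    have := Submodule.finrank_mono hle
    omega
  obtain ⟨u, huU, huU₁⟩ := SetLike.not_le_iff_exists.1 hle
  have hex : ∃ z', NegDefOn A z' W ∧
      z' * inner ℂ u (A v) + conj z' * inner ℂ (A u) v ≠ 0 := by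
    by_contra! hall
    have hev : ∀ᶠ z' in 𝓝 z, NegDefOn A z' W := by
      have := (Continuous.tendsto' (f := fun w : ℂ => ((0 : ℝ), w)) (by fun_prop) z _
        rfl).eventually hneg.eventually
      simpa using this
    obtain ⟨ε, hε, hball⟩ := Metric.eventually_nhds_iff.1 hev
    have h0 := hall z hneg
    have h1 := hall (z + (ε / 2 : ℝ)) (hball (by
      rw [dist_self_add_left, Complex.norm_real, Real.norm_eq_abs, abs_of_pos] <;> linarith))
    have h2 := hall (z + (ε / 2 : ℝ) * Complex.I) (hball (by
      rw [dist_self_add_left, norm_mul, Complex.norm_I, Complex.norm_real, Real.norm_eq_abs,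
        abs_of_pos] <;> linarith))
    simp only [map_add, map_mul, Complex.conj_ofReal, Complex.conj_I] at h1 h2
    have hε' : ((ε / 2 : ℝ) : ℂ) ≠ 0 := by
      exact_mod_cast (half_pos hε).ne'
    have h3 : inner ℂ u (A v) + inner ℂ (A u) v = 0 :=
      mul_left_cancel₀ hε' (by linear_combination h1 - h0)
    have h4 : inner ℂ u (A v) - inner ℂ (A u) v = 0 :=
      mul_left_cancel₀ (mul_ne_zero hε' Complex.I_ne_zero) (by linear_combination h2 - h0)
    have h5 : inner ℂ u (A v) = 0 := by linear_combination (h3 + h4) / 2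
    have h6 : inner ℂ (A u) v = 0 := by linear_combination (h3 - h4) / 2
    refine huU₁ ⟨⟨huU, (hφ u).trans ?_⟩, (hψ u).trans ?_⟩
    · rw [← inner_conj_symm, h6, map_zero]
    · rw [← inner_conj_symm, h5, map_zero]
  obtain ⟨z', hneg', hne⟩ := hex
  obtain ⟨s, hs⟩ := hneg'.exists_sup_span_singleton hv (fun x hx => horth x (hW hx)) hne
  have hmem : u + s • v ∉ W := fun h =>
    huU₁ ((U₁.add_mem_iff_left (U₁.smul_mem s hvU₁)).1 (hU₂₁ (hW h)))
  have h1 := Submodule.finrank_sup_span_singleton hmem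
  have h2 := hC z' _ (sup_le (hW.trans (hU₂₁.trans hU₁U))
    ((Submodule.span_singleton_le_iff_mem _ _).2 (U.add_mem huU (U.smul_mem s hvU)))) hs
  omega

/-- In dimension at most `2 * k`, the pencil always contains an isotropic vector. -/
lemma NonnegIndexGE.hasPencilIsotropicVector (hC : NonnegIndexGE A U k) (hk : 0 < k)
    (hU : finrank ℂ U ≤ 2 * k) : HasPencilIsotropicVector A U := by
  by_contra hG
  have hnondeg : ∀ z : ℂ, z ≠ 0 → ∀ v ∈ U,
      (∀ x ∈ U, z * inner ℂ x (A v) + conj z * inner ℂ (A x) v = 0) → v = 0 := by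
    intro z hz v hv hker
    obtain ⟨P, hP, hPk, hPneg⟩ := hC.exists_negDefOn hG hz
    obtain ⟨N, hN, hNk, hNneg⟩ := hC.exists_negDefOn hG (neg_ne_zero.2 hz)
    have hd : P ⊓ N = ⊥ := by
      rw [Submodule.eq_bot_iff]
      rintro x ⟨hx, hx'⟩
      by_contra h0
      exact absurd (hPneg x hx h0) (not_lt.2 (hNneg.nonneg_of_neg x hx'))
    have hsup : P ⊔ N = U := by
      refine Submodule.eq_of_le_of_finrank_le (sup_le hP hN) ?_
      have := Submodule.finrank_sup_add_finrank_inf_eq P N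
      rw [hd, finrank_bot] at this
      omega
    rw [← hsup] at hv
    obtain ⟨p, hp, n, hn, rfl⟩ := Submodule.mem_sup.1 hv
    have h1 := congrArg Complex.re (hker p (hP hp))
    have h2 := congrArg Complex.re (hker n (hN hn))
    have hre : ∀ x y : E, (z * inner ℂ x (A y) + conj z * inner ℂ (A x) y).re =
        (z * inner ℂ x (A y)).re + (z * inner ℂ y (A x)).re := by
      intro x y
      rw [Complex.add_re, ← inner_conj_symm (A x) y, ← map_mul, Complex.conj_re]
    rw [hre, map_add, inner_add_right, inner_add_left, mul_add, mul_add, Complex.add_re,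
      Complex.add_re, Complex.zero_re] at h1 h2
    have h3 : p = 0 := by
      by_contra h0
      linarith [hPneg p hp h0, hNneg.nonneg_of_neg n hn]
    subst h3
    have h4 : n = 0 := by
      by_contra h0
      have := hNneg n hn h0
      rw [neg_mul, Complex.neg_re] at this
      simp only [map_zero, inner_zero_left, inner_zero_right, mul_zero, Complex.zero_re] at h2
      linarith
    rw [h4, add_zero]
  let B : U →L[ℂ] U := U.orthogonalProjectionOnto ∘L A ∘L U.subtypeL
  have hB : ∀ x y : U, inner ℂ x (B y) = inner ℂ (x : E) (A y) := by
    intro x y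
    simp [B]
  have hB' : ∀ x y : U, inner ℂ (B x) y = inner ℂ (A x) (y : E) := by
    intro x y
    rw [← inner_conj_symm, hB, inner_conj_symm]
  let H : U →ₗ[ℂ] U := (B + ContinuousLinearMap.adjoint B : U →L[ℂ] U)
  have hH : ∀ x y : U, inner ℂ x (H y) = inner ℂ (x : E) (A y) + inner ℂ (A x) (y : E) := by
    intro x y
    simp [H, ContinuousLinearMap.adjoint_inner_right, hB, hB']
  have hHinj : Function.Injective H := by
    rw [injective_iff_map_eq_zero]
    intro v hv
    refine Subtype.ext (hnondeg 1 one_ne_zero v v.2 fun x hx => ?_)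
    rw [one_mul, map_one, one_mul, ← hH ⟨x, hx⟩ v, hv, inner_zero_right]
  let e := LinearEquiv.ofInjectiveEndo H hHinj
  have : Nontrivial U := by
    have := hC 0 ⊥ bot_le fun x hx h0 => absurd hx h0
    exact Module.nontrivial_of_finrank_pos (R := ℂ) (by omega)
  obtain ⟨μ, hμ⟩ := Module.End.exists_eigenvalue (K := ℂ) (V := U) (e.symm.toLinearMap ∘ₗ B)
  obtain ⟨v, hv⟩ := hμ.exists_hasEigenvector
  have hBv : B v = μ • H v := by
    have h1 : e.symm (B v) = μ • v := hv.apply_eq_smul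
    rw [LinearEquiv.symm_apply_eq, map_smul] at h1
    exact h1
  have hv0 : (v : E) ≠ 0 := fun h => hv.2 (Subtype.ext h)
  have hrel : ∀ x ∈ U, (1 - μ) * inner ℂ x (A v) - μ * inner ℂ (A x) v = 0 := by
    intro x hx
    have := congrArg (inner ℂ (⟨x, hx⟩ : U)) hBv
    rw [inner_smul_right, hB, hH] at this
    linear_combination this
  by_cases hq : inner ℂ (v : E) (A v) = 0
  · refine hG ⟨v, v.2, hv0, hq, -conj μ, 1 - conj μ, ?_, fun x hx => ?_⟩
    · by_contra! h
      have h1 : conj μ = 0 := neg_eq_zero.1 h.1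
      have h2 := h.2
      rw [h1] at h2
      simp at h2
    · have := congrArg conj (hrel x hx)
      simp only [map_sub, map_mul, map_one, inner_conj_symm, map_zero] at this
      linear_combination this
  · have h1 := hrel v v.2
    have h2 := congrArg conj h1
    simp only [map_sub, map_mul, map_one, inner_conj_symm, map_zero] at h2
    have hμ2 : conj μ = 1 - μ := by
      have h3 : (1 - μ - conj μ) * (inner ℂ (v : E) (A v) + inner ℂ (A v) (v : E)) = 0 := by
        linear_combination h1 + h2
      rcases mul_eq_zero.1 h3 with h | h
      · linear_combination -h
      · exact absurd (by linear_combination h1 + μ * h) hq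
    have hμ1 : 1 - μ ≠ 0 := by
      intro h
      rw [h] at hμ2
      have : μ = 0 := by simpa using hμ2
      simp [this] at h
    refine hv0 (hnondeg (Complex.I * (1 - μ)) (mul_ne_zero Complex.I_ne_zero hμ1) v v.2
      fun x hx => ?_)
    simp only [map_mul, map_sub, map_one, Complex.conj_I, hμ2]
    linear_combination Complex.I * hrel x hx

/-- A subspace on which the index bound holds for `k` contains a `k`-dimensional isotropic
subspace. -/
theorem NonnegIndexGE.exists_isotropic (hC : NonnegIndexGE A U k) :
    ∃ V ≤ U, finrank ℂ V = k ∧ ∀ x ∈ V, inner ℂ x (A x) = 0 := by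
  induction k generalizing A U with
  | zero => exact ⟨⊥, bot_le, finrank_bot ℂ E, fun x hx => by simp [(Submodule.mem_bot ℂ).1 hx]⟩
  | succ k ih =>
    have hpencil : ∀ {A : E →L[ℂ] E} {U : Submodule ℂ E}, NonnegIndexGE A U (k + 1) →
        HasPencilIsotropicVector A U →
          ∃ V ≤ U, finrank ℂ V = k + 1 ∧ ∀ x ∈ V, inner ℂ x (A x) = 0 := by
      intro A U hC hG
      obtain ⟨v, hvU, hv, U', hU', hvU', horth, hC'⟩ := hC.exists_reduction hG
      obtain ⟨V, hV, hVk, hiso⟩ := ih hC'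
      refine ⟨V ⊔ Submodule.span ℂ {v},
        sup_le (hV.trans hU') ((Submodule.span_singleton_le_iff_mem _ _).2 hvU), ?_, ?_⟩
      · rw [Submodule.finrank_sup_span_singleton fun h => hvU' (hV h), hVk]
      · intro x hx
        obtain ⟨w, hw, y, hy, rfl⟩ := Submodule.mem_sup.1 hx
        obtain ⟨c, rfl⟩ := Submodule.mem_span_singleton.1 hy
        obtain ⟨h1, h2⟩ := horth w (hV hw)
        have h3 : inner ℂ w (A v) = 0 := by rw [← inner_conj_symm, h2, map_zero]
        rw [inner_map_add_self, inner_map_smul_self, hiso w hw, hv, map_smul, inner_smul_left,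
          inner_smul_right, h1, h3]
        simp
    obtain ⟨s, hs, hCs, hGs⟩ := hC.exists_translate k.succ_pos
    obtain ⟨t, ht, hCt, hGt⟩ := hC.neg.exists_translate k.succ_pos
    obtain ⟨V, hV, hVk, hVs⟩ := hpencil hCs hGs
    obtain ⟨W, hW, hWk, hWt⟩ := hpencil hCt hGt
    have hVs' : ∀ x ∈ V, inner ℂ x (A x) = (s * ‖x‖ ^ 2 : ℝ) := by
      intro x hx
      have := hVs x hx
      rw [inner_sub_smul_one_self] at this
      linear_combination this
    have hWt' : ∀ x ∈ W, inner ℂ x (A x) = (-(t * ‖x‖ ^ 2) : ℝ) := by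
      intro x hx
      have := hWt x hx
      rw [inner_sub_smul_one_self, _root_.neg_apply, inner_neg_right] at this
      push_cast at this ⊢
      linear_combination -this
    have hdim := Submodule.finrank_sup_add_finrank_inf_eq V W
    have hC' : NonnegIndexGE A (V ⊔ W) (k + 1) := by
      intro z X hX hneg
      rcases le_total 0 z.re with hz | hz
      · rw [← hVk]
        refine finrank_add_le_of_neg_of_nonneg hX le_sup_left hneg fun x hx => ?_
        rw [hVs' x hx, Complex.re_mul_ofReal]
        positivity
      · rw [← hWk]
        refine finrank_add_le_of_neg_of_nonneg hX le_sup_right hneg fun x hx => ?_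
        rw [hWt' x hx, Complex.re_mul_ofReal]
        exact mul_nonneg_of_nonpos_of_nonpos hz (neg_nonpos.2 (by positivity))
    obtain ⟨X, hX, h⟩ := hpencil hC' (hC'.hasPencilIsotropicVector k.succ_pos (by omega))
    exact ⟨X, hX.trans (sup_le hV hW), h⟩

end

section Matrices

open Module

variable {n : ℕ} (A : Matrix (Fin n) (Fin n) ℂ) (ξ : ℝ)

lemma isHermitian_rotated :
    (Complex.exp (ξ * Complex.I) • A + Complex.exp (-(ξ * Complex.I)) • Aᴴ).IsHermitian := by
  have h : star (Complex.exp (ξ * Complex.I)) = Complex.exp (-(ξ * Complex.I)) := by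
    rw [Complex.star_def, ← Complex.exp_conj]
    simp
  have h' : star (Complex.exp (-(ξ * Complex.I))) = Complex.exp (ξ * Complex.I) := by
    rw [← h, star_star]
  rw [Matrix.IsHermitian, conjTranspose_add, conjTranspose_smul, conjTranspose_smul, h, h',
    conjTranspose_conjTranspose, add_comm]

lemma inner_toEuclideanCLM (x y : EuclideanSpace ℂ (Fin n)) :
    inner ℂ x (toEuclideanCLM (𝕜 := ℂ) A y) = star x.ofLp ⬝ᵥ A *ᵥ y.ofLp := by
  rw [EuclideanSpace.inner_eq_star_dotProduct, dotProduct_comm, ofLp_toEuclideanCLM]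

lemma re_inner_rotated (x : EuclideanSpace ℂ (Fin n)) :
    (inner ℂ x (toEuclideanLin (Complex.exp (ξ * Complex.I) • A +
      Complex.exp (-(ξ * Complex.I)) • Aᴴ) x)).re =
      2 * (Complex.exp (ξ * Complex.I) * inner ℂ x (toEuclideanCLM (𝕜 := ℂ) A x)).re := by
  have h : starRingEnd ℂ (Complex.exp (ξ * Complex.I)) = Complex.exp (-(ξ * Complex.I)) := by
    rw [← Complex.exp_conj]
    simp
  have h1 : inner ℂ x (toEuclideanLin Aᴴ x) =
      starRingEnd ℂ (inner ℂ x (toEuclideanCLM (𝕜 := ℂ) A x)) := by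
    rw [toEuclideanLin_conjTranspose_eq_adjoint, LinearMap.adjoint_inner_right, inner_conj_symm]
    rfl
  have h2 : inner ℂ x (toEuclideanLin A x) = inner ℂ x (toEuclideanCLM (𝕜 := ℂ) A x) := rfl
  rw [map_add, map_smul, map_smul, LinearMap.add_apply, LinearMap.smul_apply,
    LinearMap.smul_apply, inner_add_right, inner_smul_right, inner_smul_right, h1, h2, ← h,
    ← map_mul, Complex.add_re, Complex.conj_re]
  ring

/-- Splitting of the space according to the signs of the eigenvalues of `e^{iξ}A + e^{-iξ}A*`. -/
lemma exists_nonneg_and_negDefOn_rotated :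
    ∃ P N : Submodule ℂ (EuclideanSpace ℂ (Fin n)),
      finrank ℂ P = numNonnegEig (Complex.exp (ξ * Complex.I) • A
          + Complex.exp (-(ξ * Complex.I)) • Aᴴ) ∧
      finrank ℂ P + finrank ℂ N = n ∧
      (∀ x ∈ P, 0 ≤ (Complex.exp (ξ * Complex.I) *
        inner ℂ x (toEuclideanCLM (𝕜 := ℂ) A x)).re) ∧
      NegDefOn (toEuclideanCLM (𝕜 := ℂ) A) (Complex.exp (ξ * Complex.I)) N := by
  have hH := isHermitian_rotated A ξ
  let b := hH.eigenvectorBasis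
  have hb : ∀ i, toEuclideanLin (Complex.exp (ξ * Complex.I) • A +
      Complex.exp (-(ξ * Complex.I)) • Aᴴ) (b i) = (hH.eigenvalues i : ℂ) • b i := by
    intro i
    ext j
    exact congrFun (hH.mulVec_eigenvectorBasis i) j
  have hP := b.finrank_span_image fun i => 0 ≤ hH.eigenvalues i
  have hN := b.finrank_span_image fun i => hH.eigenvalues i < 0
  refine ⟨Submodule.span ℂ (b '' {i | 0 ≤ hH.eigenvalues i}),
    Submodule.span ℂ (b '' {i | hH.eigenvalues i < 0}), ?_, ?_, fun x hx => ?_,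
    fun x hx h0 => ?_⟩
  · rw [hP, numNonnegEig, dif_pos hH]
  · rw [hP, hN]
    have := Finset.card_filter_add_card_filter_not (s := Finset.univ)
      (fun i => 0 ≤ hH.eigenvalues i)
    simpa using this
  · have := b.inner_map_self_nonneg_of_mem_span hb hx
    rw [re_inner_rotated] at this
    linarith
  · have := b.inner_map_self_neg_of_mem_span hb hx h0
    rw [re_inner_rotated] at this
    linarith

lemma nonnegIndexGE_of_forall_le_numNonnegEig {k : ℕ}
    (h : ∀ ξ ∈ Set.Ico (0 : ℝ) (2 * Real.pi), k ≤ numNonnegEig (Complex.exp (ξ * Complex.I) • A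
      + Complex.exp (-(ξ * Complex.I)) • Aᴴ)) :
    NonnegIndexGE (toEuclideanCLM (𝕜 := ℂ) A) ⊤ k := by
  intro z W hW hneg
  let ξ := toIcoMod Real.two_pi_pos 0 z.arg
  have hξ : ξ ∈ Set.Ico (0 : ℝ) (2 * Real.pi) := by
    simpa using toIcoMod_mem_Ico Real.two_pi_pos 0 z.arg
  have hexp : (‖z‖ : ℂ) * Complex.exp (ξ * Complex.I) = z := by
    have : Complex.exp (ξ * Complex.I) = Complex.exp (z.arg * Complex.I) := by
      rw [Complex.exp_eq_exp_iff_exists_int]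
      refine ⟨-toIcoDiv Real.two_pi_pos 0 z.arg, ?_⟩
      simp only [ξ, toIcoMod]
      push_cast
      simp
      ring
    rw [this, Complex.norm_mul_exp_arg_mul_I]
  obtain ⟨P, -, hPk, -, hP, -⟩ := exists_nonneg_and_negDefOn_rotated A ξ
  refine (Nat.add_le_add_left ((h ξ hξ).trans_eq hPk.symm) _).trans
    (finrank_add_le_of_neg_of_nonneg hW le_top hneg fun x hx => ?_)
  rw [← hexp, mul_assoc, Complex.re_ofReal_mul]
  exact mul_nonneg (norm_nonneg z) (hP x hx)

lemma finrank_le_numNonnegEig_of_isotropic {V : Submodule ℂ (EuclideanSpace ℂ (Fin n))}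
    (hV : ∀ x ∈ V, inner ℂ x (toEuclideanCLM (𝕜 := ℂ) A x) = 0) :
    finrank ℂ V ≤ numNonnegEig (Complex.exp (ξ * Complex.I) • A
      + Complex.exp (-(ξ * Complex.I)) • Aᴴ) := by
  obtain ⟨P, N, hP, hPN, -, hN⟩ := exists_nonneg_and_negDefOn_rotated A ξ
  have := finrank_add_le_of_neg_of_nonneg le_top le_top hN fun x (hx : x ∈ V) => by
    rw [hV x hx, mul_zero, Complex.zero_re]
  rw [finrank_top, finrank_euclideanSpace, Fintype.card_fin] at this
  omega

end Matrices

/-- The minimum over `ξ ∈ [0, 2π)` of the number of nonnegative eigenvalues of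
`e^{iξ}A + e^{-iξ}A*` equals the maximum dimension of a totally isotropic subspace of `A`. -/
theorem min_numNonnegEig_eq_max_isotropic_dim {n : ℕ} (A : Matrix (Fin n) (Fin n) ℂ) :
    sInf {m : ℕ | ∃ ξ ∈ Set.Ico (0 : ℝ) (2 * Real.pi),
        m = numNonnegEig (Complex.exp (ξ * Complex.I) • A
          + Complex.exp (-(ξ * Complex.I)) • Aᴴ)} =
      sSup {d : ℕ | ∃ V : Submodule ℂ (Fin n → ℂ),
        (∀ x ∈ V, ∀ y ∈ V, star x ⬝ᵥ A *ᵥ y = 0) ∧ Module.finrank ℂ V = d} := by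
  let e := WithLp.linearEquiv 2 ℂ (Fin n → ℂ)
  apply le_antisymm
  · have hC := nonnegIndexGE_of_forall_le_numNonnegEig A fun ξ hξ =>
      Nat.sInf_le (s := {m : ℕ | ∃ ξ ∈ Set.Ico (0 : ℝ) (2 * Real.pi),
        m = numNonnegEig (Complex.exp (ξ * Complex.I) • A
          + Complex.exp (-(ξ * Complex.I)) • Aᴴ)}) ⟨ξ, hξ, rfl⟩
    obtain ⟨V, -, hVk, hV⟩ := hC.exists_isotropic
    refine le_csSup ⟨n, ?_⟩ ⟨V.map e.toLinearMap, ?_, ?_⟩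
    · rintro _ ⟨W, -, rfl⟩
      simpa using Submodule.finrank_le W
    · rintro _ ⟨x, hx, rfl⟩ _ ⟨y, hy, rfl⟩
      exact (inner_toEuclideanCLM A x y).symm.trans (inner_map_eq_zero_of_isotropic hV hx hy)
    · rw [← hVk]
      exact LinearEquiv.finrank_map_eq e V
  · refine csSup_le ⟨0, ⊥, by simp, by simp⟩ ?_
    rintro _ ⟨V, hV, rfl⟩
    refine le_csInf ⟨_, 0, ⟨le_rfl, Real.two_pi_pos⟩, rfl⟩ ?_
    rintro _ ⟨ξ, -, rfl⟩
    rw [← LinearEquiv.finrank_map_eq e.symm V]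
    refine finrank_le_numNonnegEig_of_isotropic A ξ ?_
    rintro _ ⟨x, hx, rfl⟩
    exact (inner_toEuclideanCLM A _ _).trans (hV x hx x hx)
end
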